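/- arXiv:1701.02827 — 2 statements merged into one kernel-verified Lean document; each statement's English description precedes it below -/
import Mathlib

section
/- One-shot variable-length lossy source coding: let X ∼ P_X be a source, 𝒴 a reproduction alphabet, d : 𝒳 × 𝒴 → [0,∞] a distortion function, and D ≥ 0. Define R(D) = inf over conditional distributions P_{Y|X} with E[d(X,Y)] ≤ D of I(X;Y), and assume R(D) < ∞. Then for every R̄ > R(D) + log₂(R(D)+1) + 6, there exist a (possibly stochastic) encoder producing Ỹ ∈ 𝒴 from X and a prefix-free binary code for Ỹ such that the expected codeword length is at most R̄ and E[d(X,Ỹ)] ≤ D. -/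
open MeasureTheory ProbabilityTheory Real
open scoped ENNReal

noncomputable section
open Classical in

/-- Kullback–Leibler divergence in bits (base-2 logarithm). -/
def klBits {α : Type*} [MeasurableSpace α] (P Q : Measure α) : ℝ≥0∞ :=
  if P ≪ Q ∧ Integrable (fun x => Real.logb 2 (P.rnDeriv Q x).toReal) P
  then ENNReal.ofReal (∫ x, Real.logb 2 (P.rnDeriv Q x).toReal ∂P)
  else ⊤

/-- Mutual information `I(X;Y)` in bits: the KL divergence between the joint law and the
product of the marginal laws. -/
def miBits {Ω 𝒳 𝒴 : Type*} [MeasurableSpace Ω] [MeasurableSpace 𝒳] [MeasurableSpace 𝒴]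
    (μ : Measure Ω) (X : Ω → 𝒳) (Y : Ω → 𝒴) : ℝ≥0∞ :=
  klBits (μ.map (fun ω => (X ω, Y ω))) ((μ.map X).prod (μ.map Y))

/-- Conditional mutual information `I(X;Z|Y)` in bits, defined via the chain rule
`I(X;Z|Y) = I(X;(Z,Y)) - I(X;Y)`. -/
def cmiBits {Ω 𝒳 𝒵 𝒴 : Type*} [MeasurableSpace Ω] [MeasurableSpace 𝒳] [MeasurableSpace 𝒵]
    [MeasurableSpace 𝒴] (μ : Measure Ω) (X : Ω → 𝒳) (Z : Ω → 𝒵) (Y : Ω → 𝒴) : ℝ≥0∞ :=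
  miBits μ X (fun ω => (Z ω, Y ω)) - miBits μ X Y

/-- Entropy `H(X)` in bits, as `I(X;X)` (equals the Shannon entropy for discrete `X`,
and `∞` otherwise). -/
def entBits {Ω 𝒳 : Type*} [MeasurableSpace Ω] [MeasurableSpace 𝒳]
    (μ : Measure Ω) (X : Ω → 𝒳) : ℝ≥0∞ :=
  miBits μ X X

/-- Conditional entropy `H(Y|Z)` in bits, as `I(Y;Y|Z)`. -/
def condEntBits {Ω 𝒴 𝒵 : Type*} [MeasurableSpace Ω] [MeasurableSpace 𝒴] [MeasurableSpace 𝒵]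
    (μ : Measure Ω) (Y : Ω → 𝒴) (Z : Ω → 𝒵) : ℝ≥0∞ :=
  cmiBits μ Y Y Z

/-- Mutual information of a joint distribution on a product space. -/
def miOfJoint {𝒳 𝒴 : Type*} [MeasurableSpace 𝒳] [MeasurableSpace 𝒴]
    (ν : Measure (𝒳 × 𝒴)) : ℝ≥0∞ :=
  miBits ν Prod.fst Prod.snd

/-- Binary strings `{0,1}*` carry the discrete σ-algebra. -/
instance : MeasurableSpace (List Bool) := ⊤


namespace OSL

section PerX

variable {𝒴 : Type*} [MeasurableSpace 𝒴]

/-- Thresholds of the greedy rejection sampler. -/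
def L (Q : Measure 𝒴) (r : 𝒴 → ℝ≥0∞) : ℕ → ℝ≥0∞
  | 0 => 0
  | k + 1 => L Q r k + ∫⁻ y, (r y - L Q r k) ∂Q

/-- Survival probabilities. -/
def S (Q : Measure 𝒴) (r : 𝒴 → ℝ≥0∞) (k : ℕ) : ℝ≥0∞ := ∫⁻ y, (r y - L Q r k) ∂Q

/-- Layer densities. -/
def a (Q : Measure 𝒴) (r : 𝒴 → ℝ≥0∞) (k : ℕ) (y : 𝒴) : ℝ≥0∞ := min (r y - L Q r k) (S Q r k)

/-- Acceptance probabilities. -/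
def b (Q : Measure 𝒴) (r : 𝒴 → ℝ≥0∞) (k : ℕ) (y : 𝒴) : ℝ≥0∞ := a Q r k y / S Q r k

/-- Probability to select index `k` given the codebook `z`. -/
def W (Q : Measure 𝒴) (r : 𝒴 → ℝ≥0∞) (k : ℕ) (z : ℕ → 𝒴) : ℝ≥0∞ :=
  (∏ j ∈ Finset.range k, (1 - b Q r j (z j))) * b Q r k (z k)

variable (Q : Measure 𝒴) (r : 𝒴 → ℝ≥0∞)

lemma L_succ (k : ℕ) : L Q r (k + 1) = L Q r k + S Q r k := rfl

lemma S_zero (hr1 : ∫⁻ y, r y ∂Q = 1) : S Q r 0 = 1 := by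
  simp [S, L, hr1]

lemma a_meas (hr : Measurable r) (k : ℕ) : Measurable (a Q r k) :=
  (hr.sub_const _).min measurable_const

lemma b_meas (hr : Measurable r) (k : ℕ) : Measurable (b Q r k) :=
  (a_meas Q r hr k).div_const _

lemma S_succ_add (hr : Measurable r) (k : ℕ) :
    S Q r (k + 1) + ∫⁻ y, a Q r k y ∂Q = S Q r k := by
  unfold S
  rw [← lintegral_add_right _ (a_meas Q r hr k)]
  refine lintegral_congr fun y => ?_
  rw [L_succ, ← tsub_tsub, a, tsub_add_min]

lemma S_anti (hr : Measurable r) : Antitone (S Q r) :=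
  antitone_nat_of_succ_le fun k => by
    rw [← S_succ_add Q r hr k]; exact le_self_add

lemma S_le_one (hr : Measurable r) (hr1 : ∫⁻ y, r y ∂Q = 1) (k : ℕ) : S Q r k ≤ 1 :=
  (S_anti Q r hr (Nat.zero_le k)).trans (S_zero Q r hr1).le

lemma S_ne_top (hr : Measurable r) (hr1 : ∫⁻ y, r y ∂Q = 1) (k : ℕ) : S Q r k ≠ ⊤ :=
  ((S_le_one Q r hr hr1 k).trans_lt ENNReal.one_lt_top).ne

lemma L_ne_top (hr : Measurable r) (hr1 : ∫⁻ y, r y ∂Q = 1) (k : ℕ) : L Q r k ≠ ⊤ := by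
  induction k with
  | zero => simp [L]
  | succ k ih => rw [L_succ]; exact ENNReal.add_ne_top.2 ⟨ih, S_ne_top Q r hr hr1 k⟩

lemma mul_S_le_L (hr : Measurable r) (k : ℕ) : (k : ℝ≥0∞) * S Q r k ≤ L Q r k := by
  induction k with
  | zero => simp
  | succ k ih =>
    rw [L_succ]
    push_cast
    rw [add_mul, one_mul]
    have h := S_anti Q r hr (Nat.le_succ k)
    exact add_le_add ((by gcongr : (k : ℝ≥0∞) * S Q r (k + 1) ≤ k * S Q r k).trans ih) h

lemma succ_mul_S_le_L (hr : Measurable r) (k : ℕ) :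
    ((k : ℝ≥0∞) + 1) * S Q r k ≤ L Q r (k + 1) := by
  rw [L_succ, add_mul, one_mul]
  exact add_le_add (mul_S_le_L Q r hr k) le_rfl

lemma sum_a (n : ℕ) (y : 𝒴) :
    ∑ k ∈ Finset.range n, a Q r k y = min (r y) (L Q r n) := by
  induction n with
  | zero => simp [L]
  | succ n ih =>
    rw [Finset.sum_range_succ, ih, L_succ, a]
    rcases le_total (r y) (L Q r n) with h | h
    · rw [min_eq_left h, tsub_eq_zero_of_le h, min_eq_left (h.trans le_self_add)]; simp
    · rw [min_eq_right h, ← min_add_add_left, add_tsub_cancel_of_le h]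

lemma S_mul_b (hr : Measurable r) (hr1 : ∫⁻ y, r y ∂Q = 1) (k : ℕ) (y : 𝒴) :
    S Q r k * b Q r k y = a Q r k y := by
  by_cases h : S Q r k = 0
  · simp [a, h]
  · exact ENNReal.mul_div_cancel h (S_ne_top Q r hr hr1 k)

lemma b_le_one (k : ℕ) (y : 𝒴) : b Q r k y ≤ 1 :=
  ENNReal.div_le_of_le_mul (by rw [one_mul]; exact min_le_right _ _)

lemma lint_one_sub_b [IsProbabilityMeasure Q] (hr : Measurable r)
    (hr1 : ∫⁻ y, r y ∂Q = 1) (k : ℕ) :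
    S Q r k * ∫⁻ y, (1 - b Q r k y) ∂Q = S Q r (k + 1) := by
  have hS := S_ne_top Q r hr hr1 k
  rw [← lintegral_const_mul (S Q r k) (f := fun y => 1 - b Q r k y)
    (measurable_const.sub (b_meas Q r hr k))]
  have h1 : ∀ y, S Q r k * (1 - b Q r k y) = S Q r k - a Q r k y := fun y => by
    rw [ENNReal.mul_sub (fun _ _ => hS), mul_one, S_mul_b Q r hr hr1]
  simp_rw [h1]
  have h2 : ∫⁻ y, a Q r k y ∂Q ≠ ⊤ := by
    have := S_succ_add Q r hr k
    intro h; rw [h] at this; simp at this; exact hS this.symm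
  rw [lintegral_sub (a_meas Q r hr k) h2 (Filter.Eventually.of_forall fun y => min_le_right _ _)]
  simp only [lintegral_const, measure_univ, mul_one]
  rw [← S_succ_add Q r hr k, ENNReal.add_sub_cancel_right h2]

lemma prod_lint [IsProbabilityMeasure Q] (hr : Measurable r)
    (hr1 : ∫⁻ y, r y ∂Q = 1) (k : ℕ) :
    ∏ j ∈ Finset.range k, ∫⁻ y, (1 - b Q r j y) ∂Q = S Q r k := by
  induction k with
  | zero => simp [S_zero Q r hr1]
  | succ k ih => rw [Finset.prod_range_succ, ih, lint_one_sub_b Q r hr hr1]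

lemma lint_W [IsProbabilityMeasure Q] (hr : Measurable r)
    (hr1 : ∫⁻ y, r y ∂Q = 1) (k : ℕ) (g : 𝒴 → ℝ≥0∞) (hg : Measurable g) :
    ∫⁻ z, W Q r k z * g (z k) ∂(Measure.infinitePi fun _ : ℕ => Q)
      = ∫⁻ y, a Q r k y * g y ∂Q := by
  let F : ℕ → 𝒴 → ℝ≥0∞ := fun j y => if j = k then b Q r k y * g y else 1 - b Q r j y
  have hF : ∀ j, Measurable (F j) := fun j => by
    by_cases h : j = k
    · simp only [F, h, if_true]; exact (b_meas Q r hr k).mul hg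
    · simp only [F, h, if_false]; exact measurable_const.sub (b_meas Q r hr j)
  have hind := iIndepFun_infinitePi (P := fun _ : ℕ => Q) (X := F) hF
  have h := lintegral_prod_eq_prod_lintegral_of_indepFun (Finset.range (k + 1)) _ hind
    (fun i => (hF i).comp (measurable_pi_apply i))
  have e : ∀ i, ∫⁻ z, F i (z i) ∂(Measure.infinitePi fun _ : ℕ => Q) = ∫⁻ y, F i y ∂Q := fun i => by
    rw [← Measure.infinitePi_map_eval (fun _ : ℕ => Q) i,
      lintegral_map (hF i) (measurable_pi_apply i)]
    simp [Measure.infinitePi_map_eval]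
  simp_rw [e, Finset.prod_range_succ] at h
  have e1 : ∀ z : ℕ → 𝒴, ∏ j ∈ Finset.range k, F j (z j)
      = ∏ j ∈ Finset.range k, (1 - b Q r j (z j)) := fun z =>
    Finset.prod_congr rfl fun j hj => by
      simp [F, (Finset.mem_range.1 hj).ne]
  have e2 : ∏ j ∈ Finset.range k, ∫⁻ y, F j y ∂Q = S Q r k := by
    rw [← prod_lint Q r hr hr1]
    exact Finset.prod_congr rfl fun j hj => by simp [F, (Finset.mem_range.1 hj).ne]
  rw [e2] at h
  simp_rw [e1] at h
  simp only [F, if_true] at h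
  simp only [W, mul_assoc]
  rw [h, ← lintegral_const_mul (S Q r k) (f := fun y => b Q r k y * g y)
    ((b_meas Q r hr k).mul hg)]
  refine lintegral_congr fun y => ?_
  rw [← mul_assoc, S_mul_b Q r hr hr1]

lemma tendsto_S (hr : Measurable r) (hfin : ∀ y, r y ≠ ⊤) (hr1 : ∫⁻ y, r y ∂Q = 1) :
    Filter.Tendsto (S Q r) Filter.atTop (nhds 0) := by
  have h := tendsto_atTop_iInf (S_anti Q r hr)
  by_cases h0 : (⨅ k, S Q r k) = 0
  · rwa [h0] at h
  · have hL : Filter.Tendsto (L Q r) Filter.atTop (nhds ⊤) := by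
      have h1 : Filter.Tendsto (fun k : ℕ => (k : ℝ≥0∞) * ⨅ k, S Q r k) Filter.atTop (nhds ⊤) := by
        have := ENNReal.Tendsto.mul_const (b := ⨅ k, S Q r k) ENNReal.tendsto_nat_nhds_top
          (Or.inl (by simp))
        rwa [ENNReal.top_mul h0] at this
      refine tendsto_of_tendsto_of_tendsto_of_le_of_le h1 tendsto_const_nhds (fun k => ?_)
        (fun k => le_top)
      exact (by gcongr; exact iInf_le _ k : (k : ℝ≥0∞) * (⨅ k, S Q r k) ≤ k * S Q r k).trans
        (mul_S_le_L Q r hr k)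
    have := tendsto_lintegral_of_dominated_convergence (μ := Q) (F := fun n y => r y - L Q r n)
      (f := fun _ => 0) r (fun n => hr.sub_const _)
      (fun n => Filter.Eventually.of_forall fun y => tsub_le_self) (by simp [hr1])
      (Filter.Eventually.of_forall fun y => by
        apply tendsto_const_nhds.congr'
        filter_upwards [hL.eventually (lt_mem_nhds (hfin y).lt_top)] with n hn
        exact (tsub_eq_zero_of_le hn.le).symm)
    simp only [lintegral_zero] at this
    exact this

lemma sum_lint_a (hr : Measurable r) (hr1 : ∫⁻ y, r y ∂Q = 1) (n : ℕ) :
    ∑ k ∈ Finset.range n, ∫⁻ y, a Q r k y ∂Q + S Q r n = 1 := by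
  induction n with
  | zero => simp [S_zero Q r hr1]
  | succ n ih => rw [Finset.sum_range_succ, add_assoc, add_comm (∫⁻ y, a Q r n y ∂Q),
      S_succ_add Q r hr, ih]

lemma tsum_lint_a (hr : Measurable r) (hfin : ∀ y, r y ≠ ⊤) (hr1 : ∫⁻ y, r y ∂Q = 1) :
    ∑' k, ∫⁻ y, a Q r k y ∂Q = 1 := by
  have h1 := (ENNReal.summable (f := fun k => ∫⁻ y, a Q r k y ∂Q)).hasSum.tendsto_sum_nat
  have h2 := h1.add (tendsto_S Q r hr hfin hr1)
  simp_rw [sum_lint_a Q r hr hr1, add_zero] at h2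
  exact tendsto_nhds_unique h2 tendsto_const_nhds

lemma sum_W (z : ℕ → 𝒴) (n : ℕ) :
    ∑ k ∈ Finset.range n, W Q r k z + ∏ j ∈ Finset.range n, (1 - b Q r j (z j)) = 1 := by
  induction n with
  | zero => simp
  | succ n ih =>
    rw [Finset.sum_range_succ, Finset.prod_range_succ, W, add_assoc, ← mul_add,
      add_tsub_cancel_of_le (b_le_one Q r n (z n)), mul_one, ih]

lemma tsum_W_le (z : ℕ → 𝒴) : ∑' k, W Q r k z ≤ 1 :=
  ENNReal.tsum_le_of_sum_range_le fun n => by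
    rw [← sum_W Q r z n]; exact le_self_add

end PerX

end OSL

namespace OSL

open InformationTheory in
lemma klFun_tangent {x t : ℝ} (hx : 0 ≤ x) (ht : 0 < t) :
    klFun t + (x - t) * Real.log t ≤ klFun x := by
  unfold klFun
  rcases hx.eq_or_lt with h | h
  · subst h; simp; nlinarith
  · have h1 := Real.log_le_sub_one_of_pos (div_pos ht h)
    rw [Real.log_div ht.ne' h.ne'] at h1
    have h2 : x * (Real.log t - Real.log x) ≤ x * (t / x - 1) := by gcongr
    have h3 : x * (t / x - 1) = t - x := by field_simp
    nlinarith

section PerX2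

variable {𝒴 : Type*} [MeasurableSpace 𝒴] (Q : Measure 𝒴) (r : 𝒴 → ℝ≥0∞)

lemma L_one (hr1 : ∫⁻ y, r y ∂Q = 1) : L Q r 1 = 1 := by
  rw [L_succ, S_zero Q r hr1]; simp [L]

lemma one_le_L (hr1 : ∫⁻ y, r y ∂Q = 1) (k : ℕ) : 1 ≤ L Q r (k + 1) := by
  induction k with
  | zero => exact (L_one Q r hr1).ge
  | succ k ih => rw [L_succ]; exact ih.trans le_self_add

lemma one_le_L_toReal (hr : Measurable r) (hr1 : ∫⁻ y, r y ∂Q = 1) (k : ℕ) :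
    1 ≤ (L Q r (k + 1)).toReal := by
  have := ENNReal.toReal_mono (L_ne_top Q r hr hr1 (k + 1)) (one_le_L Q r hr1 k)
  simpa using this

open InformationTheory in
lemma pointwise_real (hr : Measurable r) (hr1 : ∫⁻ y, r y ∂Q = 1)
    (y : 𝒴) (n : ℕ) :
    1 / 2 + ∑ k ∈ Finset.range n, (a Q r (k + 1) y).toReal * Real.log (L Q r (k + 1)).toReal
      ≤ klFun (min (r y) (L Q r (n + 1))).toReal + (a Q r 0 y).toReal * Real.log 2 := by
  induction n with
  | zero =>
    have h := sum_a Q r 1 y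
    simp at h
    rw [← h]
    have := klFun_tangent (x := (a Q r 0 y).toReal) (t := 1 / 2) ENNReal.toReal_nonneg (by norm_num)
    have h2 : Real.log (1 / 2) = - Real.log 2 := by rw [one_div, Real.log_inv]
    rw [h2] at this
    have h3 : klFun (1 / 2) = 1 / 2 * (- Real.log 2) + 1 / 2 := by
      rw [klFun, h2]; ring
    rw [h3] at this
    simp
    linarith
  | succ n ih =>
    rw [Finset.sum_range_succ]
    have hL := L_ne_top Q r hr hr1 (n + 1)
    have hS := S_ne_top Q r hr hr1 (n + 1)
    have ha : a Q r (n + 1) y ≠ ⊤ := ne_top_of_le_ne_top hS (min_le_right _ _)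
    have hm : min (r y) (L Q r (n + 1)) ≠ ⊤ := ne_top_of_le_ne_top hL (min_le_right _ _)
    have h1 : min (r y) (L Q r (n + 1 + 1)) = min (r y) (L Q r (n + 1)) + a Q r (n + 1) y := by
      rw [← sum_a Q r, ← sum_a Q r, Finset.sum_range_succ]
    rw [h1, ENNReal.toReal_add hm ha]
    rcases le_total (r y) (L Q r (n + 1)) with h | h
    · have : a Q r (n + 1) y = 0 := by simp [a, tsub_eq_zero_of_le h]
      rw [this]; simpa using ih
    · rw [min_eq_right h] at ih ⊢
      have h1 := one_le_L_toReal Q r hr hr1 n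
      have := klFun_tangent (x := (L Q r (n + 1)).toReal + (a Q r (n + 1) y).toReal)
        (t := (L Q r (n + 1)).toReal) (by positivity) (by linarith)
      rw [add_sub_cancel_left] at this
      linarith

open InformationTheory in
lemma pointwise_real' (hr : Measurable r) (hfin : ∀ y, r y ≠ ⊤) (hr1 : ∫⁻ y, r y ∂Q = 1)
    (y : 𝒴) (n : ℕ) :
    1 / 2 + ∑ k ∈ Finset.range n, (a Q r (k + 1) y).toReal * Real.log (L Q r (k + 1)).toReal
      ≤ klFun (r y).toReal + (a Q r 0 y).toReal * Real.log 2 := by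
  refine (pointwise_real Q r hr hr1 y n).trans ?_
  gcongr
  rcases le_total (r y) (L Q r (n + 1)) with h | h
  · rw [min_eq_left h]
  · rw [min_eq_right h]
    have h1 := one_le_L_toReal Q r hr hr1 n
    have := klFun_tangent (x := (r y).toReal) (t := (L Q r (n + 1)).toReal) (by positivity)
      (by linarith)
    have h2 := ENNReal.toReal_mono (hfin y) h
    have h3 := mul_nonneg (sub_nonneg.2 h2) (Real.log_nonneg h1)
    linarith

open InformationTheory in
lemma integrated [IsProbabilityMeasure Q] (hr : Measurable r) (hfin : ∀ y, r y ≠ ⊤)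
    (hr1 : ∫⁻ y, r y ∂Q = 1) (n : ℕ) :
    ENNReal.ofReal (1 / 2) + ∑ k ∈ Finset.range n, (∫⁻ y, a Q r (k + 1) y ∂Q) *
        ENNReal.ofReal (Real.log (L Q r (k + 1)).toReal)
      ≤ ∫⁻ y, ENNReal.ofReal (klFun (r y).toReal) ∂Q
        + (∫⁻ y, a Q r 0 y ∂Q) * ENNReal.ofReal (Real.log 2) := by
  have ha : ∀ k y, a Q r k y ≠ ⊤ := fun k y =>
    ne_top_of_le_ne_top (S_ne_top Q r hr hr1 k) (min_le_right _ _)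
  have hlog : ∀ k, 0 ≤ Real.log (L Q r (k + 1)).toReal := fun k =>
    Real.log_nonneg (one_le_L_toReal Q r hr hr1 k)
  have hlog2 : 0 ≤ Real.log 2 := Real.log_nonneg (by norm_num)
  calc _ = ∫⁻ y, (ENNReal.ofReal (1 / 2) + ∑ k ∈ Finset.range n, a Q r (k + 1) y *
        ENNReal.ofReal (Real.log (L Q r (k + 1)).toReal)) ∂Q := by
        rw [lintegral_add_left measurable_const, lintegral_finsetSum _
          (fun k _ => (a_meas Q r hr (k + 1)).mul_const _)]
        congr 1
        · simp
        · exact Finset.sum_congr rfl fun k _ =>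
            (lintegral_mul_const _ (a_meas Q r hr (k + 1))).symm
    _ ≤ ∫⁻ y, (ENNReal.ofReal (klFun (r y).toReal) + a Q r 0 y * ENNReal.ofReal (Real.log 2)) ∂Q := by
        refine lintegral_mono fun y => ?_
        have h := ENNReal.ofReal_le_ofReal (pointwise_real' Q r hr hfin hr1 y n)
        rw [ENNReal.ofReal_add (by norm_num) (Finset.sum_nonneg fun k _ =>
            mul_nonneg ENNReal.toReal_nonneg (hlog k)),
          ENNReal.ofReal_sum_of_nonneg (fun k _ => mul_nonneg ENNReal.toReal_nonneg (hlog k)),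
          ENNReal.ofReal_add (klFun_nonneg ENNReal.toReal_nonneg)
            (mul_nonneg ENNReal.toReal_nonneg hlog2)] at h
        simpa only [ENNReal.ofReal_mul ENNReal.toReal_nonneg, ENNReal.ofReal_toReal (ha _ _)] using h
    _ = _ := by
        rw [lintegral_add_right _ ((a_meas Q r hr 0).mul_const _),
          lintegral_mul_const _ (a_meas Q r hr 0)]

open InformationTheory in
lemma real_entropy (s : ℕ → ℝ) (hs0 : s 0 = 1) (hs : ∀ k, 0 ≤ s k)
    (hanti : ∀ k, s (k + 1) ≤ s k) (n : ℕ) :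
    ∑ k ∈ Finset.range n, (s k - s (k + 1)) * (- Real.log (s k)) ≤ klFun (s n) := by
  induction n with
  | zero => simp [hs0, klFun]
  | succ n ih =>
    rw [Finset.sum_range_succ]
    rcases (hs n).eq_or_lt with h | h
    · have : s (n + 1) = 0 := le_antisymm (h ▸ hanti n) (hs _)
      rw [← h] at ih
      simpa [this, ← h] using ih
    · have := klFun_tangent (hs (n + 1)) h
      nlinarith

open InformationTheory in
lemma log_bound [IsProbabilityMeasure Q] (hr : Measurable r) (hfin : ∀ y, r y ≠ ⊤)
    (hr1 : ∫⁻ y, r y ∂Q = 1) :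
    ∑' k : ℕ, (∫⁻ y, a Q r k y ∂Q) * ENNReal.ofReal (Real.log (k + 1))
      ≤ ∫⁻ y, ENNReal.ofReal (klFun (r y).toReal) ∂Q + ENNReal.ofReal (2 * Real.log 2) := by
  by_cases hD : ∫⁻ y, ENNReal.ofReal (klFun (r y).toReal) ∂Q = ⊤
  · rw [hD]; simp
  set Dx := ∫⁻ y, ENNReal.ofReal (klFun (r y).toReal) ∂Q with hDx
  refine ENNReal.tsum_le_of_sum_range_le fun n => ?_
  refine (Finset.sum_le_sum_of_subset (Finset.range_mono (Nat.le_succ n))).trans ?_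
  have hSt := S_ne_top Q r hr hr1
  set s : ℕ → ℝ := fun k => (S Q r k).toReal with hs
  have hP : ∀ k, ∫⁻ y, a Q r k y ∂Q ≠ ⊤ := fun k h => by
    have := S_succ_add Q r hr k
    rw [h] at this; simp at this; exact hSt k this.symm
  have hp : ∀ k, (∫⁻ y, a Q r k y ∂Q) = ENNReal.ofReal (s k - s (k + 1)) := fun k => by
    have h := congrArg ENNReal.toReal (S_succ_add Q r hr k)
    rw [ENNReal.toReal_add (hSt _) (hP k)] at h
    rw [← ENNReal.ofReal_toReal (hP k)]
    congr 1
    simp only [hs]; linarith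
  have hanti : ∀ k, s (k + 1) ≤ s k := fun k =>
    ENNReal.toReal_mono (hSt k) (S_anti Q r hr (Nat.le_succ k))
  have hs0 : s 0 = 1 := by simp [hs, S_zero Q r hr1]
  have hsnn : ∀ k, 0 ≤ s k := fun k => ENNReal.toReal_nonneg
  have hs1 : ∀ k, s k ≤ 1 := fun k => by
    have := ENNReal.toReal_mono (by simp) (S_le_one Q r hr hr1 k); simpa using this
  have hlog : ∀ k, 0 ≤ Real.log (L Q r (k + 1)).toReal := fun k =>
    Real.log_nonneg (one_le_L_toReal Q r hr hr1 k)
  have hlog2 : 0 ≤ Real.log 2 := Real.log_nonneg (by norm_num)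
  have hpn : ∀ k, 0 ≤ s k - s (k + 1) := fun k => sub_nonneg.2 (hanti k)
  -- the integrated inequality in real form
  have hI : 1 / 2 + ∑ k ∈ Finset.range n, (s (k + 1) - s (k + 1 + 1)) *
      Real.log (L Q r (k + 1)).toReal ≤ Dx.toReal + (s 0 - s 1) * Real.log 2 := by
    have h := integrated Q r hr hfin hr1 n
    simp_rw [hp, ← ENNReal.ofReal_mul (hpn _)] at h
    rw [← ENNReal.ofReal_sum_of_nonneg (fun k _ => mul_nonneg (hpn _) (hlog k)),
      ← ENNReal.ofReal_add (by norm_num) (Finset.sum_nonneg fun k _ =>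
        mul_nonneg (hpn _) (hlog k)), ← hDx, ← ENNReal.ofReal_toReal hD,
      ← ENNReal.ofReal_add ENNReal.toReal_nonneg (mul_nonneg (hpn 0) hlog2)] at h
    exact (ENNReal.ofReal_le_ofReal_iff (add_nonneg ENNReal.toReal_nonneg
      (mul_nonneg (hpn 0) hlog2))).1 h
  have hE := real_entropy s hs0 hsnn hanti (n + 1)
  have hE1 : klFun (s (n + 1)) ≤ 1 := by
    have := Real.log_nonpos (hsnn (n + 1)) (hs1 (n + 1))
    rw [klFun]
    nlinarith [hsnn (n + 1)]
  rw [Finset.sum_range_succ'] at hE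
  have hterm : ∀ k, (s (k + 1) - s (k + 1 + 1)) * Real.log ((k + 1 : ℕ) + 1) ≤
      (s (k + 1) - s (k + 1 + 1)) * Real.log (L Q r (k + 1)).toReal
      + (s (k + 1) - s (k + 1 + 1)) * Real.log 2
      + (s (k + 1) - s (k + 1 + 1)) * (- Real.log (s (k + 1))) := fun k => by
    rw [← mul_add, ← mul_add]
    rcases (hsnn (k + 1)).eq_or_lt with h | h
    · have : s (k + 1 + 1) = 0 := le_antisymm (h ▸ hanti (k + 1)) (hsnn _)
      simp [this, ← h]
    · refine mul_le_mul_of_nonneg_left ?_ (hpn _)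
      have hL1 := one_le_L_toReal Q r hr hr1 k
      have hLt := L_ne_top Q r hr hr1 (k + 1)
      have h1 := succ_mul_S_le_L Q r hr (k + 1)
      rw [L_succ] at h1
      have h2 := ENNReal.toReal_mono (ENNReal.add_ne_top.2 ⟨hLt, hSt _⟩) h1
      rw [ENNReal.toReal_mul, ENNReal.toReal_add hLt (hSt _),
        ENNReal.toReal_add (by simp) (by simp)] at h2
      simp only [ENNReal.toReal_natCast, ENNReal.toReal_one] at h2
      have h3 : (((k + 1 : ℕ) : ℝ) + 1) * s (k + 1) ≤ (L Q r (k + 1)).toReal * 2 := by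
        have := hs1 (k + 1)
        simp only [hs] at this ⊢
        linarith
      have h4 := Real.log_le_log (by positivity) h3
      rw [Real.log_mul (by positivity) h.ne', Real.log_mul (by positivity) (by norm_num)] at h4
      linarith
  have hsum := Finset.sum_le_sum (s := Finset.range n) fun k _ => hterm k
  rw [Finset.sum_add_distrib, Finset.sum_add_distrib, ← Finset.sum_mul,
    Finset.sum_range_sub' (fun k => s (k + 1))] at hsum
  simp_rw [hp, ← ENNReal.ofReal_mul (hpn _)]
  rw [← ENNReal.ofReal_sum_of_nonneg (fun k _ => mul_nonneg (hpn _)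
      (Real.log_nonneg (by linarith [(Nat.cast_nonneg k : (0:ℝ) ≤ k)]))),
    Finset.sum_range_succ', ← ENNReal.ofReal_toReal hD,
    ← ENNReal.ofReal_add ENNReal.toReal_nonneg (by positivity)]
  apply ENNReal.ofReal_le_ofReal
  have hl2 : 1 / 2 ≤ Real.log 2 := by linarith [Real.log_two_gt_d9]
  have hmul := mul_nonneg (hsnn (n + 1)) hlog2
  simp only [hs0, Real.log_one, neg_zero, mul_zero, add_zero, Nat.cast_zero, zero_add] at *
  nlinarith

end PerX2

end OSL

namespace OSL

lemma derand_real {Z : Type*} [MeasurableSpace Z] (P : Measure Z) [IsProbabilityMeasure P]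
    (α β : Z → ℝ) (hα : Integrable α P) (hβ : Integrable β P) (T : Z → Prop)
    (hT : ∀ᵐ z ∂P, T z) (h1 : ∫ z, α z ∂P < 0) (h2 : ∫ z, β z ∂P ≤ 0) :
    ∃ z0 z1 : Z, T z0 ∧ T z1 ∧ ∃ w0 w1 : ℝ, 0 ≤ w0 ∧ 0 ≤ w1 ∧ w0 + w1 = 1 ∧
      w0 * α z0 + w1 * α z1 ≤ 0 ∧ w0 * β z0 + w1 * β z1 ≤ 0 := by
  by_contra! hcon
  have hsingle : ∀ z, T z → β z ≤ 0 → 0 < α z := fun z hz hb => by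
    by_contra! ha
    have := hcon z z hz hz 1 0 (by norm_num) le_rfl (by norm_num) (by simpa using ha)
    simp at this
    linarith
  by_cases hc : ∃ z, T z ∧ β z < 0
  · obtain ⟨zz, hzz, hbzz⟩ := hc
    have hpair : ∀ z0 z1, T z0 → T z1 → β z0 < 0 → 0 < β z1 → 0 < β z1 * α z0 - β z0 * α z1 := by
      intro z0 z1 t0 t1 b0 b1
      by_contra! hle
      have hpos : 0 < β z1 - β z0 := by linarith
      have := hcon z0 z1 t0 t1 (β z1 / (β z1 - β z0)) (-β z0 / (β z1 - β z0))
        (by positivity) (div_nonneg (by linarith) hpos.le) (by field_simp; ring) (by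
          rw [div_mul_eq_mul_div, div_mul_eq_mul_div, ← add_div]
          exact div_nonpos_of_nonpos_of_nonneg (by linarith) hpos.le)
      rw [div_mul_eq_mul_div, div_mul_eq_mul_div, ← add_div] at this
      have e : β z1 * β z0 + -β z0 * β z1 = 0 := by ring
      rw [e] at this
      simp at this
    set V : Set ℝ := insert 0 {v | ∃ z, T z ∧ 0 < β z ∧ v = - α z / β z} with hV
    have hub : ∀ z, T z → β z < 0 → ∀ v ∈ V, v ≤ α z / (- β z) := by
      intro z hz hb v hv
      rcases hv with rfl | ⟨z1, t1, b1, rfl⟩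
      · exact div_nonneg (hsingle z hz hb.le).le (by linarith)
      · rw [div_le_div_iff₀ b1 (by linarith)]
        have := hpair z z1 hz t1 hb b1
        nlinarith
    have hbdd : BddAbove V := ⟨_, hub zz hzz hbzz⟩
    set lam := sSup V with hlam
    have hlam0 : 0 ≤ lam := le_csSup hbdd (Set.mem_insert _ _)
    have hnn : ∀ z, T z → 0 ≤ α z + lam * β z := by
      intro z hz
      rcases lt_trichotomy (β z) 0 with hb | hb | hb
      · have : lam ≤ α z / (- β z) := csSup_le ⟨0, Set.mem_insert _ _⟩ (hub z hz hb)
        rw [le_div_iff₀ (by linarith)] at this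
        linarith
      · have := hsingle z hz hb.le
        rw [hb]; linarith
      · have : - α z / β z ≤ lam := le_csSup hbdd (Set.mem_insert_of_mem _ ⟨z, hz, hb, rfl⟩)
        rw [div_le_iff₀ hb] at this
        linarith
    have hInt : 0 ≤ ∫ z, (α z + lam * β z) ∂P :=
      integral_nonneg_of_ae (hT.mono fun z hz => hnn z hz)
    rw [integral_add hα (hβ.const_mul lam), integral_const_mul] at hInt
    nlinarith [mul_nonneg hlam0 (neg_nonneg.2 h2)]
  · push Not at hc
    have hb0 : 0 ≤ᵐ[P] β := hT.mono fun z hz => hc z hz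
    have hb1 : β =ᵐ[P] 0 := by
      rw [← integral_eq_zero_iff_of_nonneg_ae hb0 hβ]
      exact le_antisymm h2 (integral_nonneg_of_ae hb0)
    have : 0 ≤ ∫ z, α z ∂P := integral_nonneg_of_ae (by
      filter_upwards [hT, hb1] with z hz hb
      exact (hsingle z hz (le_of_eq hb)).le)
    linarith

lemma derand {Z : Type*} [MeasurableSpace Z] (P : Measure Z) [IsProbabilityMeasure P]
    (A B : Z → ℝ≥0∞) (hA : Measurable A) (hB : Measurable B) (T : Z → Prop)
    (hT : ∀ᵐ z ∂P, T z) (m D : ℝ≥0∞) (h1 : ∫⁻ z, A z ∂P < m) (hm : m ≠ ⊤)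
    (h2 : ∫⁻ z, B z ∂P ≤ D) :
    ∃ z0 z1 : Z, T z0 ∧ T z1 ∧ ∃ w0 w1 : ℝ≥0∞, w0 + w1 = 1 ∧
      w0 * A z0 + w1 * A z1 ≤ m ∧ w0 * B z0 + w1 * B z1 ≤ D := by
  by_cases hD : D = ⊤
  · subst hD
    have : ∃ z, T z ∧ A z ≤ m := by
      by_contra! hcon
      have : ∫⁻ _, m ∂P ≤ ∫⁻ z, A z ∂P := lintegral_mono_ae (hT.mono fun z hz => (hcon z hz).le)
      simp at this
      exact absurd h1 (not_lt.2 this)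
    obtain ⟨z, hz, hle⟩ := this
    exact ⟨z, z, hz, hz, 1, 0, by simp, by simpa using hle, le_top⟩
  · have hAf : ∫⁻ z, A z ∂P ≠ ⊤ := (h1.trans_le le_top).ne
    have hBf : ∫⁻ z, B z ∂P ≠ ⊤ := (h2.trans_lt (lt_top_iff_ne_top.2 hD)).ne
    have hAa := ae_lt_top hA hAf
    have hBa := ae_lt_top hB hBf
    have iA := integrable_toReal_of_lintegral_ne_top hA.aemeasurable hAf
    have iB := integrable_toReal_of_lintegral_ne_top hB.aemeasurable hBf
    obtain ⟨z0, z1, ⟨t0, a0, b0⟩, ⟨t1, a1, b1⟩, w0, w1, hw0, hw1, hw, e1, e2⟩ :=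
      derand_real P (fun z => (A z).toReal - m.toReal) (fun z => (B z).toReal - D.toReal)
        (iA.sub (integrable_const _)) (iB.sub (integrable_const _))
        (fun z => T z ∧ A z < ⊤ ∧ B z < ⊤)
        (by filter_upwards [hT, hAa, hBa] with z x y w using ⟨x, y, w⟩)
        (by
          rw [integral_sub iA (integrable_const _), integral_toReal hA.aemeasurable hAa]
          simp only [integral_const, probReal_univ, one_smul]
          exact sub_neg.2 ((ENNReal.toReal_lt_toReal hAf hm).2 h1))
        (by
          rw [integral_sub iB (integrable_const _), integral_toReal hB.aemeasurable hBa]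
          simp only [integral_const, probReal_univ, one_smul]
          exact sub_nonpos.2 ((ENNReal.toReal_le_toReal hBf hD).2 h2))
    have key : ∀ x y c : ℝ≥0∞, x < ⊤ → y < ⊤ → c ≠ ⊤ →
        w0 * (x.toReal - c.toReal) + w1 * (y.toReal - c.toReal) ≤ 0 →
        ENNReal.ofReal w0 * x + ENNReal.ofReal w1 * y ≤ c := by
      intro x y c hx hy hc h
      have h' : w0 * x.toReal + w1 * y.toReal ≤ c.toReal := by
        have : c.toReal = (w0 + w1) * c.toReal := by rw [hw, one_mul]
        rw [this]; linarith
      have := ENNReal.ofReal_le_ofReal h'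
      rwa [ENNReal.ofReal_add (by positivity) (by positivity), ENNReal.ofReal_mul hw0,
        ENNReal.ofReal_mul hw1, ENNReal.ofReal_toReal hx.ne, ENNReal.ofReal_toReal hy.ne,
        ENNReal.ofReal_toReal hc] at this
    refine ⟨z0, z1, t0, t1, ENNReal.ofReal w0, ENNReal.ofReal w1, ?_, key _ _ _ a0 a1 hm e1,
      key _ _ _ b0 b1 hD e2⟩
    rw [← ENNReal.ofReal_add hw0 hw1, hw, ENNReal.ofReal_one]

section Global

variable {𝒳 𝒴 : Type*} [MeasurableSpace 𝒳] [MeasurableSpace 𝒴]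
  (PX : Measure 𝒳) (Q : Measure 𝒴) [IsProbabilityMeasure PX] [IsProbabilityMeasure Q]
  (r : 𝒳 × 𝒴 → ℝ≥0∞)

/-- Slice of the density. -/
def rx (r : 𝒳 × 𝒴 → ℝ≥0∞) (x : 𝒳) : 𝒴 → ℝ≥0∞ := fun y => r (x, y)

lemma rx_meas (hr : Measurable r) (x : 𝒳) : Measurable (rx r x) := hr.comp measurable_prodMk_left

lemma L_measx (hr : Measurable r) (k : ℕ) : Measurable fun x => L Q (rx r x) k := by
  induction k with
  | zero => simp only [L]; exact measurable_const
  | succ k ih =>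
    simp only [L]
    refine ih.add ?_
    exact Measurable.lintegral_prod_right' (f := fun p : 𝒳 × 𝒴 => r p - L Q (rx r p.1) k)
      (hr.sub (ih.comp measurable_fst))

lemma S_measx (hr : Measurable r) (k : ℕ) : Measurable fun x => S Q (rx r x) k :=
  Measurable.lintegral_prod_right' (f := fun p : 𝒳 × 𝒴 => r p - L Q (rx r p.1) k)
      (hr.sub ((L_measx Q r hr k).comp measurable_fst))

lemma a_measx (hr : Measurable r) (k : ℕ) : Measurable fun p : 𝒳 × 𝒴 => a Q (rx r p.1) k p.2 :=
  (hr.sub ((L_measx Q r hr k).comp measurable_fst)).min ((S_measx Q r hr k).comp measurable_fst)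

lemma b_measx (hr : Measurable r) (k : ℕ) : Measurable fun p : 𝒳 × 𝒴 => b Q (rx r p.1) k p.2 :=
  (a_measx Q r hr k).div ((S_measx Q r hr k).comp measurable_fst)

lemma b_measxz (hr : Measurable r) (k : ℕ) :
    Measurable fun p : 𝒳 × (ℕ → 𝒴) => b Q (rx r p.1) k (p.2 k) :=
  (b_measx Q r hr k).comp
    (measurable_fst.prodMk ((measurable_pi_apply k).comp measurable_snd))

lemma W_measx (hr : Measurable r) (k : ℕ) :
    Measurable fun p : 𝒳 × (ℕ → 𝒴) => W Q (rx r p.1) k p.2 := by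
  unfold W
  exact (Finset.measurable_prod _ fun j _ => measurable_const.sub (b_measxz Q r hr j)).mul
    (b_measxz Q r hr k)

/-- Conditional expectation of a cost given the codebook. -/
def E (h : ℕ → 𝒳 × 𝒴 → ℝ≥0∞) (z : ℕ → 𝒴) : ℝ≥0∞ :=
  ∫⁻ x, ∑' k, W Q (rx r x) k z * h k (x, z k) ∂PX

lemma E_integrand_meas (hr : Measurable r) (h : ℕ → 𝒳 × 𝒴 → ℝ≥0∞) (hh : ∀ k, Measurable (h k)) :
    Measurable fun p : 𝒳 × (ℕ → 𝒴) => ∑' k, W Q (rx r p.1) k p.2 * h k (p.1, p.2 k) :=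
  Measurable.tsum fun k => (W_measx Q r hr k).mul ((hh k).comp
    (measurable_fst.prodMk ((measurable_pi_apply k).comp measurable_snd)))

lemma E_meas (hr : Measurable r) (h : ℕ → 𝒳 × 𝒴 → ℝ≥0∞) (hh : ∀ k, Measurable (h k)) :
    Measurable (E PX Q r h) :=
  Measurable.lintegral_prod_left' (E_integrand_meas Q r hr h hh)

lemma lint_E (hr : Measurable r) (hr1 : ∀ x, ∫⁻ y, r (x, y) ∂Q = 1)
    (h : ℕ → 𝒳 × 𝒴 → ℝ≥0∞) (hh : ∀ k, Measurable (h k)) :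
    ∫⁻ z, E PX Q r h z ∂(Measure.infinitePi fun _ : ℕ => Q)
      = ∫⁻ x, ∑' k, ∫⁻ y, a Q (rx r x) k y * h k (x, y) ∂Q ∂PX := by
  unfold E
  have hm : AEMeasurable (Function.uncurry fun (z : ℕ → 𝒴) (x : 𝒳) =>
      ∑' k, W Q (rx r x) k z * h k (x, z k)) ((Measure.infinitePi fun _ : ℕ => Q).prod PX) :=
    ((E_integrand_meas Q r hr h hh).comp measurable_swap).aemeasurable
  rw [lintegral_lintegral_swap hm]
  refine lintegral_congr fun x => ?_
  rw [lintegral_tsum]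
  · refine tsum_congr fun k => ?_
    exact lint_W Q (rx r x) (rx_meas r hr x) (hr1 x) k (fun y => h k (x, y))
      ((hh k).comp measurable_prodMk_left)
  · intro k
    exact (((W_measx Q r hr k).comp measurable_prodMk_left).mul ((hh k).comp
      (measurable_const.prodMk (measurable_pi_apply k)))).aemeasurable

open InformationTheory in
lemma lint_E_log (hr : Measurable r) (hfin : ∀ p, r p ≠ ⊤) (hr1 : ∀ x, ∫⁻ y, r (x, y) ∂Q = 1) :
    ∫⁻ z, E PX Q r (fun k _ => ENNReal.ofReal (Real.log (k + 1))) z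
        ∂(Measure.infinitePi fun _ : ℕ => Q)
      ≤ ∫⁻ p, ENNReal.ofReal (klFun (r p).toReal) ∂(PX.prod Q) + ENNReal.ofReal (2 * Real.log 2) := by
  rw [lint_E PX Q r hr hr1 _ (fun k => measurable_const)]
  have hm : Measurable fun p => ENNReal.ofReal (klFun (r p).toReal) := by fun_prop
  rw [lintegral_prod _ hm.aemeasurable]
  calc _ ≤ ∫⁻ x, (∫⁻ y, ENNReal.ofReal (klFun (r (x, y)).toReal) ∂Q
        + ENNReal.ofReal (2 * Real.log 2)) ∂PX := by
        refine lintegral_mono fun x => ?_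
        have := log_bound Q (rx r x) (rx_meas r hr x) (fun y => hfin _) (hr1 x)
        simp_rw [lintegral_mul_const _ (a_meas Q (rx r x) (rx_meas r hr x) _)]
        exact this
    _ = _ := by
        rw [lintegral_add_right _ measurable_const]; simp

lemma lint_E_d (hr : Measurable r) (hr1 : ∀ x, ∫⁻ y, r (x, y) ∂Q = 1)
    (d : 𝒳 × 𝒴 → ℝ≥0∞) (hd : Measurable d) :
    ∫⁻ z, E PX Q r (fun _ => d) z ∂(Measure.infinitePi fun _ : ℕ => Q)
      ≤ ∫⁻ p, r p * d p ∂(PX.prod Q) := by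
  rw [lint_E PX Q r hr hr1 _ (fun k => hd), lintegral_prod (fun p => r p * d p) (hr.mul hd).aemeasurable]
  refine lintegral_mono fun x => ?_
  rw [← lintegral_tsum]
  · refine lintegral_mono fun y => ?_
    rw [ENNReal.tsum_mul_right]
    refine mul_le_mul_left ?_ _
    refine ENNReal.tsum_le_of_sum_range_le fun n => ?_
    rw [sum_a]; exact min_le_left _ _
  · intro k
    exact ((a_meas Q (rx r x) (rx_meas r hr x) k).mul
      (hd.comp measurable_prodMk_left)).aemeasurable

lemma E_one (hr : Measurable r) (hfin : ∀ p, r p ≠ ⊤) (hr1 : ∀ x, ∫⁻ y, r (x, y) ∂Q = 1) :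
    ∀ᵐ z ∂(Measure.infinitePi fun _ : ℕ => Q), ∀ᵐ x ∂PX, ∑' k, W Q (rx r x) k z = 1 := by
  have h := lint_E PX Q r hr hr1 (fun _ _ => 1) (fun _ => measurable_const)
  have hle : ∀ z, E PX Q r (fun _ _ => 1) z ≤ 1 := fun z => by
    unfold E
    calc _ ≤ ∫⁻ x, 1 ∂PX := lintegral_mono fun x => by simpa using tsum_W_le Q (rx r x) z
      _ = 1 := by simp
  have h1 : ∫⁻ z, E PX Q r (fun _ _ => 1) z ∂(Measure.infinitePi fun _ : ℕ => Q) = 1 := by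
    rw [h]
    simp only [mul_one]
    simp_rw [tsum_lint_a Q (rx r _) (rx_meas r hr _) (fun y => hfin _) (hr1 _)]
    simp
  have h2 := ae_eq_of_ae_le_of_lintegral_le (μ := Measure.infinitePi fun _ : ℕ => Q)
    (f := E PX Q r (fun _ _ => 1)) (g := fun _ => 1) (Filter.Eventually.of_forall hle)
    (by rw [h1]; simp) measurable_const.aemeasurable (by rw [h1]; simp)
  filter_upwards [h2] with z hz
  have h3 := ae_eq_of_ae_le_of_lintegral_le (μ := PX) (f := fun x => ∑' k, W Q (rx r x) k z)
    (g := fun _ => 1) (Filter.Eventually.of_forall fun x => tsum_W_le Q (rx r x) z)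
    (by simp only [E, mul_one] at hz; rw [hz]; simp) measurable_const.aemeasurable
    (by simp only [E, mul_one] at hz; rw [hz]; simp)
  exact h3

end Global

end OSL

namespace OSL

open InformationTheory in
lemma density {𝒳 𝒴 : Type*} [MeasurableSpace 𝒳] [MeasurableSpace 𝒴]
    (PX : Measure 𝒳) (Q : Measure 𝒴) [IsProbabilityMeasure PX] [IsProbabilityMeasure Q]
    (ν : Measure (𝒳 × 𝒴)) [IsProbabilityMeasure ν] (hfst : ν.fst = PX)
    (hac : ν ≪ PX.prod Q) :
    ∃ r : 𝒳 × 𝒴 → ℝ≥0∞, Measurable r ∧ (∀ p, r p ≠ ⊤) ∧ (∀ x, ∫⁻ y, r (x, y) ∂Q = 1) ∧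
      r =ᵐ[PX.prod Q] ν.rnDeriv (PX.prod Q) := by
  set r0 := ν.rnDeriv (PX.prod Q) with hr0
  have hm0 : Measurable r0 := Measure.measurable_rnDeriv _ _
  set r1 : 𝒳 × 𝒴 → ℝ≥0∞ := fun p => if r0 p = ⊤ then 0 else r0 p with hr1
  have hm1 : Measurable r1 := Measurable.ite (hm0 (measurableSet_singleton _)) measurable_const hm0
  have e1 : r1 =ᵐ[PX.prod Q] r0 := by
    filter_upwards [Measure.rnDeriv_lt_top ν (PX.prod Q)] with p hp
    simp only [hr1]; rw [if_neg hp.ne]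
  have hwd : (PX.prod Q).withDensity r1 = ν := by
    rw [withDensity_congr_ae e1]; exact Measure.withDensity_rnDeriv_eq _ _ hac
  set g : 𝒳 → ℝ≥0∞ := fun x => ∫⁻ y, r1 (x, y) ∂Q with hg
  have hgm : Measurable g := hm1.lintegral_prod_right'
  have hg1 : g =ᵐ[PX] fun _ => 1 := by
    refine ae_eq_of_forall_setLIntegral_eq_of_sigmaFinite hgm measurable_const fun s hs _ => ?_
    have h1 : ν (s ×ˢ Set.univ) = PX s := by
      rw [← hfst, Measure.fst_apply hs]; congr 1; ext p; simp
    rw [← hwd, withDensity_apply _ (hs.prod MeasurableSet.univ), ← Measure.prod_restrict,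
      lintegral_prod _ hm1.aemeasurable] at h1
    simpa using h1
  refine ⟨fun p => if g p.1 = 1 then r1 p else 1, ?_, ?_, ?_, ?_⟩
  · exact Measurable.ite ((hgm.comp measurable_fst) (measurableSet_singleton _)) hm1 measurable_const
  · intro p
    simp only [hr1]; split_ifs <;> simp_all
  · intro x
    by_cases hx : g x = 1
    · simp only [hx, if_true]; exact hx
    · simp only [hx, if_false]; simp
  · have : ∀ᵐ p ∂(PX.prod Q), g p.1 = 1 :=
      Measure.quasiMeasurePreserving_fst.ae hg1
    filter_upwards [this, e1] with p hp hp1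
    rw [if_pos hp, hp1]

open InformationTheory in
lemma density_kl {α : Type*} [MeasurableSpace α] (ν ρ : Measure α) [IsProbabilityMeasure ν]
    [IsProbabilityMeasure ρ] (r : α → ℝ≥0∞) (hac : ν ≪ ρ)
    (hInt : Integrable (fun x => Real.logb 2 (ν.rnDeriv ρ x).toReal) ν)
    (hr : r =ᵐ[ρ] ν.rnDeriv ρ) :
    ∫⁻ p, ENNReal.ofReal (klFun (r p).toReal) ∂ρ
      = ENNReal.ofReal ((∫ x, Real.logb 2 (ν.rnDeriv ρ x).toReal ∂ν) * Real.log 2) := by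
  have e : llr ν ρ = fun x => Real.logb 2 (ν.rnDeriv ρ x).toReal * Real.log 2 := by
    ext x
    simp only [llr, Real.logb]
    field_simp
  have hi : Integrable (llr ν ρ) ν := by rw [e]; exact hInt.mul_const _
  rw [lintegral_congr_ae (g := fun p => ENNReal.ofReal (klFun (ν.rnDeriv ρ p).toReal))
    (by filter_upwards [hr] with p hp; rw [hp]), ← klDiv_eq_lintegral_klFun_of_ac hac,
    klDiv_of_ac_of_integrable hac hi, e, integral_mul_const]
  simp

lemma density_d {α : Type*} [MeasurableSpace α] (ν ρ : Measure α) [IsProbabilityMeasure ν]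
    [IsProbabilityMeasure ρ] (r d : α → ℝ≥0∞) (hac : ν ≪ ρ) (hd : Measurable d)
    (hr : r =ᵐ[ρ] ν.rnDeriv ρ) :
    ∫⁻ p, r p * d p ∂ρ = ∫⁻ p, d p ∂ν := by
  rw [lintegral_congr_ae (g := fun p => ν.rnDeriv ρ p * d p)
    (by filter_upwards [hr] with p hp; rw [hp])]
  conv_rhs => rw [← Measure.withDensity_rnDeriv_eq _ _ hac]
  rw [lintegral_withDensity_eq_lintegral_mul _ (Measure.measurable_rnDeriv _ _) hd]
  rfl

end OSL

namespace OSL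

/-- `n` low-order bits of `m`. -/
def bits : ℕ → ℕ → List Bool
  | 0, _ => []
  | n + 1, m => m.testBit n :: bits n m

lemma bits_length (n m : ℕ) : (bits n m).length = n := by
  induction n with
  | zero => rfl
  | succ n ih => simp [bits, ih]

lemma bits_testBit (n m m' : ℕ) (h : bits n m = bits n m') (i : ℕ) (hi : i < n) :
    m.testBit i = m'.testBit i := by
  induction n with
  | zero => omega
  | succ n ih =>
    simp only [bits, List.cons.injEq] at h
    rcases Nat.lt_succ_iff_lt_or_eq.1 hi with h1 | rfl
    · exact ih h.2 h1
    · exact h.1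

lemma bits_inj (n m m' : ℕ) (hm : m < 2 ^ n) (hm' : m' < 2 ^ n) (h : bits n m = bits n m') :
    m = m' := by
  apply Nat.eq_of_testBit_eq
  intro i
  by_cases hi : i < n
  · exact bits_testBit n m m' h i hi
  · have : 2 ^ n ≤ 2 ^ i := Nat.pow_le_pow_right (by norm_num) (not_lt.1 hi)
    rw [Nat.testBit_lt_two_pow (hm.trans_le this), Nat.testBit_lt_two_pow (hm'.trans_le this)]

/-- Unary code. -/
def unary (u : ℕ) (l : List Bool) : List Bool := List.replicate u true ++ false :: l

lemma unary_prefix (u v : ℕ) (l l' : List Bool) (h : unary u l <+: unary v l') :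
    u = v ∧ l <+: l' := by
  induction u generalizing v with
  | zero =>
    cases v with
    | zero => simpa [unary] using h
    | succ v => simp [unary, List.replicate_succ] at h
  | succ u ih =>
    cases v with
    | zero => simp [unary, List.replicate_succ] at h
    | succ v =>
      simp only [unary, List.replicate_succ, List.cons_append, List.cons_prefix_cons, true_and] at h
      obtain ⟨h1, h2⟩ := ih v h
      exact ⟨by rw [h1], h2⟩

lemma append_prefix_of_length {l l' t t' : List Bool} (hl : l.length = l'.length)
    (h : l ++ t <+: l' ++ t') : l = l' ∧ t <+: t' := by
  obtain ⟨s, hs⟩ := h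
  rw [List.append_assoc] at hs
  obtain ⟨h1, h2⟩ := List.append_inj hs hl
  exact ⟨h1, ⟨s, h2⟩⟩

/-- The Rice-type code on `Bool × ℕ`. -/
def code (b : ℕ) (p : Bool × ℕ) : List Bool :=
  p.1 :: unary (Nat.log 2 (p.2 + 1) / 2 ^ b)
    (bits b (Nat.log 2 (p.2 + 1) % 2 ^ b) ++
      bits (Nat.log 2 (p.2 + 1)) (p.2 + 1 - 2 ^ Nat.log 2 (p.2 + 1)))

lemma code_length (b : ℕ) (p : Bool × ℕ) :
    (code b p).length = 2 + Nat.log 2 (p.2 + 1) / 2 ^ b + b + Nat.log 2 (p.2 + 1) := by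
  simp only [code, unary, List.length_cons, List.length_append, List.length_replicate, bits_length]
  ring

lemma code_prefix (b : ℕ) (p q : Bool × ℕ) (h : code b p <+: code b q) : p = q := by
  obtain ⟨i, k⟩ := p
  obtain ⟨j, l⟩ := q
  simp only [code, List.cons_prefix_cons] at h
  obtain ⟨rfl, h⟩ := h
  obtain ⟨h1, h⟩ := unary_prefix _ _ _ _ h
  obtain ⟨h2, h⟩ := append_prefix_of_length (by simp [bits_length]) h
  have hpos : 0 < 2 ^ b := by positivity
  have h3 := bits_inj _ _ _ (Nat.mod_lt _ hpos) (Nat.mod_lt _ hpos) h2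
  have hn : Nat.log 2 (k + 1) = Nat.log 2 (l + 1) := by
    rw [← Nat.div_add_mod (Nat.log 2 (k + 1)) (2 ^ b), h1, h3, Nat.div_add_mod]
  rw [← hn] at h
  have h4 := h.eq_of_length (by simp [bits_length])
  have hk1 := Nat.pow_log_le_self 2 (x := k + 1) (by omega)
  have hk2 := Nat.lt_pow_succ_log_self (b := 2) (by norm_num) (k + 1)
  have hl1 := Nat.pow_log_le_self 2 (x := l + 1) (by omega)
  have hl2 := Nat.lt_pow_succ_log_self (b := 2) (by norm_num) (l + 1)
  rw [← hn] at hl1 hl2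
  rw [pow_succ] at hk2 hl2
  have h5 := bits_inj _ _ _ (by omega) (by omega) h4
  have : k = l := by omega
  rw [this]

lemma code_length_le (b : ℕ) (p : Bool × ℕ) :
    ((code b p).length : ℝ) ≤ 2 + b + (1 + 1 / 2 ^ b) / Real.log 2 * Real.log (p.2 + 1) := by
  rw [code_length]
  push_cast
  have hl : (Nat.log 2 (p.2 + 1) : ℝ) ≤ Real.log (p.2 + 1) / Real.log 2 := by
    have := Real.natLog_le_logb (p.2 + 1) 2
    simpa [Real.logb] using this
  have hd : ((Nat.log 2 (p.2 + 1) / 2 ^ b : ℕ) : ℝ) ≤ (Nat.log 2 (p.2 + 1) : ℝ) / 2 ^ b := by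
    have := @Nat.cast_div_le ℝ _ _ _ (Nat.log 2 (p.2 + 1)) (2 ^ b)
    simpa using this
  have h2 : (Nat.log 2 (p.2 + 1) : ℝ) / 2 ^ b ≤ Real.log (p.2 + 1) / Real.log 2 / 2 ^ b := by
    gcongr
  have e : (1 + 1 / 2 ^ b) / Real.log 2 * Real.log (p.2 + 1)
    = Real.log (p.2 + 1) / Real.log 2 + Real.log (p.2 + 1) / Real.log 2 / 2 ^ b := by
    ring
  rw [e]
  linarith

lemma two_rpow_le {s : ℝ} (h0 : 0 ≤ s) (h1 : s ≤ 1) : (2 : ℝ) ^ s ≤ 1 + s := by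
  have := rpow_one_add_le_one_add_mul_self (s := 1) (by norm_num) h0 h1
  norm_num at this
  linarith

/-- Choice of the Rice parameter. -/
lemma choose_b (I : ℝ) (hI : 0 ≤ I) :
    ∃ b : ℕ, 2 + b + (1 + 1 / 2 ^ b) * (I + 2) ≤ I + Real.logb 2 (I + 1) + 6 := by
  set m := I + 2 with hm
  have hm2 : (2:ℝ) ≤ m := by linarith
  have hl1 : 0 ≤ Real.logb 2 m := Real.logb_nonneg (by norm_num) (by linarith)
  refine ⟨⌊Real.logb 2 m⌋₊, ?_⟩
  set b := ⌊Real.logb 2 m⌋₊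
  have hb1 : (b : ℝ) ≤ Real.logb 2 m := Nat.floor_le hl1
  have hb2 : Real.logb 2 m < b + 1 := Nat.lt_floor_add_one _
  have hpw : m / 2 ^ b = (2:ℝ) ^ (Real.logb 2 m - b) := by
    rw [Real.rpow_sub (by norm_num), Real.rpow_logb (by norm_num) (by norm_num) (by linarith),
      Real.rpow_natCast]
  have h := two_rpow_le (s := Real.logb 2 m - b) (by linarith) (by linarith)
  rw [← hpw] at h
  have hlog : Real.logb 2 m ≤ Real.logb 2 (I + 1) + 1 := by
    rw [show Real.logb 2 (I + 1) + 1 = Real.logb 2 ((I + 1) * 2) by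
      rw [Real.logb_mul (by linarith) (by norm_num)]; simp]
    exact Real.logb_le_logb_of_le (by norm_num) (by linarith) (by linarith)
  have e : (1 + 1 / 2 ^ b) * m = m + m / 2 ^ b := by ring
  rw [e]
  linarith

lemma choose_I (R Rbar : ℝ) (hR0 : 0 ≤ R) (hR : R + Real.logb 2 (R + 1) + 6 < Rbar) :
    ∃ I, R < I ∧ I + Real.logb 2 (I + 1) + 6 ≤ Rbar := by
  have hc : ContinuousAt (fun I : ℝ => I + Real.logb 2 (I + 1) + 6) R := by
    unfold Real.logb
    have : ContinuousAt (fun I : ℝ => Real.log (I + 1)) R :=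
      ContinuousAt.log (by fun_prop) (by linarith)
    fun_prop
  have h := hc.eventually (gt_mem_nhds hR)
  have h' : ∀ᶠ I in nhdsWithin R (Set.Ioi R), I + Real.logb 2 (I + 1) + 6 < Rbar :=
    h.filter_mono nhdsWithin_le_nhds
  obtain ⟨I, h1, h2⟩ := (h'.and self_mem_nhdsWithin).exists
  exact ⟨I, h2, h1.le⟩

/-- Transport the code to the reproduction alphabet. -/
lemma code_on {𝒴 : Type*} [MeasurableSpace 𝒴] [MeasurableSingletonClass 𝒴]
    [MeasurableSpace (List Bool)]
    (b : ℕ) (f : Bool × ℕ → 𝒴) :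
    ∃ c : 𝒴 → List Bool, Measurable c ∧ (∀ p, (c (f p)).length ≤ (code b p).length) ∧
      ∀ y₁ ∈ Set.range f, ∀ y₂ ∈ Set.range f, c y₁ <+: c y₂ → y₁ = y₂ := by
  classical
  have hex : ∀ y ∈ Set.range f, ∃ p, f p = y ∧
      ∀ q, f q = y → (code b p).length ≤ (code b q).length := by
    rintro y ⟨p0, hp0⟩
    have := Set.Nonempty.image (fun p => (code b p).length) (s := {p | f p = y}) ⟨p0, hp0⟩
    obtain ⟨p, hp, hpe⟩ := Nat.sInf_mem this
    refine ⟨p, hp, fun q hq => ?_⟩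
    have hle := Nat.sInf_le (Set.mem_image_of_mem (fun p => (code b p).length)
      (show q ∈ {p | f p = y} from hq))
    rw [← hpe] at hle
    exact hle
  choose! g hg1 hg2 using hex
  refine ⟨fun y => if y ∈ Set.range f then code b (g y) else [], ?_, ?_, ?_⟩
  · refine (measurable_const (a := ([] : List Bool))).measurable_of_countable_ne
      ((Set.countable_range f).mono ?_)
    intro y hy
    by_contra hn
    exact hy (if_neg hn).symm
  · intro p
    simp only [Set.mem_range_self, if_true]
    exact hg2 _ (Set.mem_range_self p) p rfl
  · intro y₁ h₁ y₂ h₂ h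
    simp only [h₁, h₂, if_true] at h
    rw [← hg1 y₁ h₁, code_prefix b _ _ h, hg1 y₂ h₂]

end OSL

namespace OSL

lemma space {𝒳 : Type*} [MeasurableSpace 𝒳] [StandardBorelSpace 𝒳]
    (PX : Measure 𝒳) [IsProbabilityMeasure PX] (q : Bool × ℕ → 𝒳 → ℝ≥0∞)
    (hq : ∀ i, Measurable (q i)) (hq1 : ∀ᵐ x ∂PX, ∑' i, q i x = 1) :
    ∃ (Ω : Type) (_ : MeasurableSpace Ω) (μ : Measure Ω) (_ : IsProbabilityMeasure μ)
      (X : Ω → 𝒳) (J : Ω → Bool × ℕ), Measurable X ∧ Measurable J ∧ μ.map X = PX ∧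
      ∀ f : 𝒳 × (Bool × ℕ) → ℝ≥0∞, Measurable f →
        ∫⁻ ω, f (X ω, J ω) ∂μ = ∫⁻ x, ∑' i, q i x * f (x, i) ∂PX := by
  have : Nonempty 𝒳 := PX.nonempty_of_neZero
  have he := measurableEmbedding_embeddingReal 𝒳
  set e := embeddingReal 𝒳
  obtain ⟨g, hg, hge⟩ := he.exists_measurable_extend (measurable_id (α := 𝒳)) (fun _ => ‹_›)
  have hge' : ∀ x, g (e x) = x := fun x => congrFun hge x
  set μ : Measure (ℝ × (Bool × ℕ)) :=
    Measure.sum fun i => (PX.withDensity (q i)).map (fun x => (e x, i)) with hμ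
  have key : ∀ f : 𝒳 × (Bool × ℕ) → ℝ≥0∞, Measurable f →
        ∫⁻ ω, f (g ω.1, ω.2) ∂μ = ∫⁻ x, ∑' i, q i x * f (x, i) ∂PX := by
    intro f hf
    rw [hμ, lintegral_sum_measure, lintegral_tsum]
    · refine tsum_congr fun i => ?_
      rw [lintegral_map (by fun_prop) (he.measurable.prodMk measurable_const)]
      simp only [hge']
      have hfi : Measurable fun x => f (x, i) := hf.comp (measurable_id.prodMk measurable_const)
      rw [lintegral_withDensity_eq_lintegral_mul _ (hq i) hfi]
      rfl
    · intro i
      exact ((hq i).mul (hf.comp (measurable_id.prodMk measurable_const))).aemeasurable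
  have key1 : ∀ s : Set 𝒳, MeasurableSet s → μ ((fun ω => g ω.1) ⁻¹' s) = PX s := by
    intro s hs
    have h := key (fun p => s.indicator 1 p.1)
      ((measurable_const.indicator hs).comp measurable_fst)
    have hm : MeasurableSet ((fun ω : ℝ × (Bool × ℕ) => g ω.1) ⁻¹' s) :=
      (hg.comp measurable_fst) hs
    rw [← lintegral_indicator_one hm, ← lintegral_indicator_one hs]
    refine Eq.trans ?_ (h.trans ?_)
    · rfl
    · refine lintegral_congr_ae ?_
      filter_upwards [hq1] with x hx
      rw [ENNReal.tsum_mul_right, hx, one_mul]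
  have hmap : μ.map (fun ω => g ω.1) = PX := by
    ext s hs
    have hgm : Measurable fun ω : ℝ × (Bool × ℕ) => g ω.1 := hg.comp measurable_fst
    rw [Measure.map_apply hgm hs, key1 s hs]
  refine ⟨ℝ × (Bool × ℕ), inferInstance, μ, ⟨?_⟩, fun ω => g ω.1, Prod.snd,
    hg.comp measurable_fst, measurable_snd, hmap, key⟩
  have := key1 Set.univ MeasurableSet.univ
  simpa using this

end OSL

namespace OSL

lemma mix_E {𝒳 𝒴 : Type*} [MeasurableSpace 𝒳] [MeasurableSpace 𝒴]
    (PX : Measure 𝒳) (Q : Measure 𝒴) [IsProbabilityMeasure PX] [IsProbabilityMeasure Q]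
    (r : 𝒳 × 𝒴 → ℝ≥0∞) (hr : Measurable r) (w : Bool → ℝ≥0∞) (z : Bool → ℕ → 𝒴)
    (h : ℕ → 𝒳 × 𝒴 → ℝ≥0∞) (hh : ∀ k, Measurable (h k)) :
    ∫⁻ x, ∑' i : Bool × ℕ, w i.1 * W Q (rx r x) i.2 (z i.1) * h i.2 (x, z i.1 i.2) ∂PX
      = w false * E PX Q r h (z false) + w true * E PX Q r h (z true) := by
  have hm : ∀ j, Measurable fun x => ∑' k, W Q (rx r x) k (z j) * h k (x, z j k) := fun j =>
    Measurable.tsum fun k => ((W_measx Q r hr k).comp (measurable_prodMk_right (y := z j))).mul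
      ((hh k).comp (measurable_prodMk_right (y := z j k)))
  have e : ∀ x, ∑' i : Bool × ℕ, w i.1 * W Q (rx r x) i.2 (z i.1) * h i.2 (x, z i.1 i.2)
      = w false * (∑' k, W Q (rx r x) k (z false) * h k (x, z false k))
        + w true * (∑' k, W Q (rx r x) k (z true) * h k (x, z true k)) := by
    intro x
    rw [ENNReal.tsum_prod', tsum_bool, ← ENNReal.tsum_mul_left, ← ENNReal.tsum_mul_left]
    simp only [mul_assoc]
  simp_rw [e]
  rw [lintegral_add_left ((hm false).const_mul _), lintegral_const_mul _ (hm false),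
    lintegral_const_mul _ (hm true)]
  rfl

end OSL

/-- **One-shot variable-length lossy source coding** (Theorem 2).
Let `X ∼ P_X`, `d : 𝒳 × 𝒴 → [0,∞]` a distortion measure and `D ≥ 0`, and let
`R(D) = inf { I(X;Y) : E[d(X,Y)] ≤ D }` (infimum over joint laws with first marginal `P_X`)
be finite.  Then for every `Rbar > R(D) + log₂(R(D)+1) + 6` there is a (possibly stochastic)
encoder producing `Yt` from `X` and a prefix-free binary code for `Yt` with expected codeword
length at most `Rbar` and `E[d(X,Yt)] ≤ D`. -/
theorem one_shot_lossy_source_coding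
    {𝒳 𝒴 : Type*}
    [TopologicalSpace 𝒳] [PolishSpace 𝒳] [MeasurableSpace 𝒳] [BorelSpace 𝒳]
    [TopologicalSpace 𝒴] [PolishSpace 𝒴] [MeasurableSpace 𝒴] [BorelSpace 𝒴]
    (PX : Measure 𝒳) [IsProbabilityMeasure PX]
    (d : 𝒳 × 𝒴 → ℝ≥0∞) (hd : Measurable d) (D : ℝ≥0∞)
    (RD : ℝ≥0∞)
    (hRD : RD = ⨅ (ν : Measure (𝒳 × 𝒴)) (_ : IsProbabilityMeasure ν) (_ : ν.fst = PX)
      (_ : ∫⁻ p, d p ∂ν ≤ D), miOfJoint ν)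
    (hRDfin : RD ≠ ⊤)
    (Rbar : ℝ) (hR : Rbar > RD.toReal + Real.logb 2 (RD.toReal + 1) + 6) :
    ∃ (Ω : Type) (_ : MeasurableSpace Ω) (μ : Measure Ω) (_ : IsProbabilityMeasure μ)
      (X : Ω → 𝒳) (Yt : Ω → 𝒴) (c : 𝒴 → List Bool),
      Measurable X ∧ Measurable Yt ∧ Measurable c ∧
      -- the source has distribution P_X ; Yt is produced from X (possibly stochastically,
      -- i.e. Yt may depend on extra randomness of the space Ω)
      μ.map X = PX ∧
      -- Yt a.s. takes values in a countable set on which the code is a prefix-free code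
      (∃ S : Set 𝒴, S.Countable ∧ (∀ᵐ ω ∂μ, Yt ω ∈ S) ∧
        ∀ y₁ ∈ S, ∀ y₂ ∈ S, c y₁ <+: c y₂ → y₁ = y₂) ∧
      -- expected codeword length at most Rbar
      ∫ ω, ((c (Yt ω)).length : ℝ) ∂μ ≤ Rbar ∧
      -- expected distortion at most D
      ∫⁻ ω, d (X ω, Yt ω) ∂μ ≤ D := by
  have hRD0 : 0 ≤ RD.toReal := ENNReal.toReal_nonneg
  obtain ⟨I, hI1, hI2⟩ := OSL.choose_I RD.toReal Rbar hRD0 hR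
  have hI0 : 0 ≤ I := hRD0.trans hI1.le
  have hlt : RD < ENNReal.ofReal I := (ENNReal.lt_ofReal_iff_toReal_lt hRDfin).2 hI1
  rw [hRD] at hlt
  simp only [iInf_lt_iff] at hlt
  obtain ⟨ν, hν, hfst, hνD, hmi⟩ := hlt
  set Q : Measure 𝒴 := ν.snd with hQ
  have hQp : IsProbabilityMeasure Q := by rw [hQ]; infer_instance
  have hmi' : miOfJoint ν = klBits ν (PX.prod Q) := by
    unfold miOfJoint miBits
    have h1 : ν.map (fun ω : 𝒳 × 𝒴 => (ω.1, ω.2)) = ν := Measure.map_id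
    have h2 : ν.map Prod.fst = PX := hfst
    have h3 : ν.map Prod.snd = Q := rfl
    rw [h1, h2, h3]
  rw [hmi'] at hmi
  unfold klBits at hmi
  split_ifs at hmi with hc
  swap
  · exact absurd hmi not_top_lt
  obtain ⟨hac, hInt⟩ := hc
  have hIν : ∫ x, Real.logb 2 (ν.rnDeriv (PX.prod Q) x).toReal ∂ν < I := by
    by_contra! hcon
    exact absurd hmi (not_lt.2 (ENNReal.ofReal_le_ofReal hcon))
  obtain ⟨r, hr, hfin, hr1, hre⟩ := OSL.density PX Q ν hfst hac
  have hkl := OSL.density_kl ν (PX.prod Q) r hac hInt hre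
  have hdd := OSL.density_d ν (PX.prod Q) r d hac hd hre
  have hlog2 : 0 < Real.log 2 := Real.log_pos (by norm_num)
  set hlog : ℕ → 𝒳 × 𝒴 → ℝ≥0∞ := fun k _ => ENNReal.ofReal (Real.log (k + 1)) with hhlog
  have hA : ∫⁻ z, OSL.E PX Q r hlog z ∂(Measure.infinitePi fun _ : ℕ => Q)
      < ENNReal.ofReal ((I + 2) * Real.log 2) := by
    refine (OSL.lint_E_log PX Q r hr hfin hr1).trans_lt ?_
    rw [hkl, show (I + 2) * Real.log 2 = I * Real.log 2 + 2 * Real.log 2 by ring,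
      ENNReal.ofReal_add (by positivity) (by positivity)]
    refine ENNReal.add_lt_add_right ENNReal.ofReal_ne_top ?_
    rw [ENNReal.ofReal_lt_ofReal_iff]
    · exact mul_lt_mul_of_pos_right hIν hlog2
    · exact mul_pos (lt_of_le_of_lt hRD0 hI1) hlog2
  have hB : ∫⁻ z, OSL.E PX Q r (fun _ => d) z ∂(Measure.infinitePi fun _ : ℕ => Q) ≤ D :=
    (OSL.lint_E_d PX Q r hr hr1 d hd).trans (hdd.le.trans hνD)
  obtain ⟨z0, z1, t0, t1, w0, w1, hw, hwA, hwB⟩ := OSL.derand _ _ _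
    (OSL.E_meas PX Q r hr hlog (fun _ => measurable_const))
    (OSL.E_meas PX Q r hr (fun _ => d) (fun _ => hd)) _
    (OSL.E_one PX Q r hr hfin hr1) _ _ hA ENNReal.ofReal_ne_top hB
  set z : Bool → ℕ → 𝒴 := fun j => bif j then z1 else z0 with hz
  set w : Bool → ℝ≥0∞ := fun j => bif j then w1 else w0 with hw'
  obtain ⟨b, hb⟩ := OSL.choose_b I hI0
  obtain ⟨c, hcm, hcl, hcp⟩ := OSL.code_on b (fun p : Bool × ℕ => z p.1 p.2)
  have hmix := OSL.mix_E PX Q r hr w z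
  have hqm : ∀ i : Bool × ℕ, Measurable fun x => w i.1 * OSL.W Q (OSL.rx r x) i.2 (z i.1) :=
    fun i => Measurable.const_mul
      ((OSL.W_measx Q r hr i.2).comp (measurable_id.prodMk measurable_const)) _
  have hq1 : ∀ᵐ x ∂PX, ∑' i : Bool × ℕ, w i.1 * OSL.W Q (OSL.rx r x) i.2 (z i.1) = 1 := by
    filter_upwards [t0, t1] with x h0 h1
    rw [ENNReal.tsum_prod', tsum_bool]
    simp only [hz, hw', cond_true, cond_false]
    rw [ENNReal.tsum_mul_left, ENNReal.tsum_mul_left, h0, h1, mul_one, mul_one, hw]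
  obtain ⟨Ω, mΩ, μ, hμ, X, J, hX, hJ, hmap, hf⟩ := OSL.space PX _ hqm hq1
  have hzm : Measurable fun p : Bool × ℕ => z p.1 p.2 := measurable_of_countable _
  refine ⟨Ω, mΩ, μ, hμ, X, fun ω => z (J ω).1 (J ω).2, c, hX, hzm.comp hJ, hcm, hmap,
    ⟨Set.range (fun p : Bool × ℕ => z p.1 p.2), Set.countable_range _,
      Filter.Eventually.of_forall fun ω => ⟨J ω, rfl⟩, hcp⟩, ?_, ?_⟩
  · set κ : ℝ := (1 + 1 / 2 ^ b) / Real.log 2 with hκ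
    have hκ0 : 0 ≤ κ := by positivity
    have hlm : Measurable fun p : 𝒳 × (Bool × ℕ) => ENNReal.ofReal (Real.log ((p.2.2 : ℝ) + 1)) :=
      (measurable_of_countable (fun k : ℕ => ENNReal.ofReal (Real.log ((k : ℝ) + 1)))).comp
        (measurable_snd.comp measurable_snd)
    have hEl : ∫⁻ ω, ENNReal.ofReal (Real.log (((J ω).2 : ℝ) + 1)) ∂μ
        ≤ ENNReal.ofReal ((I + 2) * Real.log 2) := by
      rw [hf (fun p => ENNReal.ofReal (Real.log ((p.2.2 : ℝ) + 1))) hlm]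
      exact (hmix hlog (fun _ => measurable_const)).le.trans hwA
    have hlen : ∀ ω, ((c (z (J ω).1 (J ω).2)).length : ℝ)
        ≤ 2 + b + κ * Real.log (((J ω).2 : ℝ) + 1) := fun ω =>
      le_trans (by exact_mod_cast hcl (J ω)) (OSL.code_length_le b (J ω))
    have hlogn : ∀ k : ℕ, 0 ≤ Real.log ((k : ℝ) + 1) := fun k =>
      Real.log_nonneg (by linarith [(Nat.cast_nonneg k : (0:ℝ) ≤ k)])
    have hlint : ∫⁻ ω, ENNReal.ofReal ((c (z (J ω).1 (J ω).2)).length : ℝ) ∂μ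
        ≤ ENNReal.ofReal (2 + b + κ * ((I + 2) * Real.log 2)) := by
      calc _ ≤ ∫⁻ ω, (ENNReal.ofReal (2 + b)
              + ENNReal.ofReal κ * ENNReal.ofReal (Real.log (((J ω).2 : ℝ) + 1))) ∂μ := by
            refine lintegral_mono fun ω => ?_
            rw [← ENNReal.ofReal_mul hκ0, ← ENNReal.ofReal_add (by positivity)
              (mul_nonneg hκ0 (hlogn _))]
            exact ENNReal.ofReal_le_ofReal (hlen ω)
        _ = ENNReal.ofReal (2 + b)
              + ENNReal.ofReal κ * ∫⁻ ω, ENNReal.ofReal (Real.log (((J ω).2 : ℝ) + 1)) ∂μ := by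
            rw [lintegral_add_left measurable_const, lintegral_const_mul' _ _ ENNReal.ofReal_ne_top]
            simp
        _ ≤ ENNReal.ofReal (2 + b) + ENNReal.ofReal κ * ENNReal.ofReal ((I + 2) * Real.log 2) := by
            gcongr
        _ = _ := by
            rw [← ENNReal.ofReal_mul hκ0, ← ENNReal.ofReal_add (by positivity) (by positivity)]
    have hlm' : Measurable fun l : List Bool => (l.length : ℝ) := fun s _ => trivial
    have hLm : Measurable fun ω => ((c (z (J ω).1 (J ω).2)).length : ℝ) :=
      hlm'.comp (hcm.comp (hzm.comp hJ))
    change ∫ ω, ((c (z (J ω).1 (J ω).2)).length : ℝ) ∂μ ≤ Rbar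
    rw [integral_eq_lintegral_of_nonneg_ae (Filter.Eventually.of_forall fun ω => Nat.cast_nonneg _)
      hLm.aestronglyMeasurable]
    refine (ENNReal.toReal_le_of_le_ofReal (by positivity) hlint).trans ?_
    have e : κ * ((I + 2) * Real.log 2) = (1 + 1 / 2 ^ b) * (I + 2) := by
      rw [hκ]; field_simp
    rw [e]
    linarith
  · have hdm : Measurable fun p : 𝒳 × (Bool × ℕ) => d (p.1, z p.2.1 p.2.2) :=
      hd.comp (measurable_fst.prodMk (hzm.comp measurable_snd))
    rw [hf (fun p => d (p.1, z p.2.1 p.2.2)) hdm]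
    exact (hmix (fun _ => d) (fun _ => hd)).le.trans hwB
end
end

section
/- Key lemma for one-shot lossy coding: let X ∼ P_X, let d : 𝒳 × 𝒴 → [0,∞] be a distortion function, and let P_{Y|X} be any conditional distribution with E[d(X,Y)] ≤ D and I(X;Y) < ∞. Then there exists a random variable Ỹ, generated from X using only one additional independent Bernoulli random bit Q (i.e., Ỹ = f_Q(X) for two deterministic functions f₀, f₁ and Q ∼ Bern(λ) independent of X), such that H(Ỹ) ≤ I(X;Y) + log₂(I(X;Y)+1) + 5 and E[d(X,Ỹ)] ≤ D. -/
open MeasureTheory ProbabilityTheory Real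
open scoped ENNReal

noncomputable section
lemma gibbs_aux (p q : ℝ) (hp : 0 ≤ p) (hq : 0 < q) (hp1 : p ≤ 1) (hq1 : q ≤ 1) :
    ENNReal.ofReal (-Real.logb 2 p) * ENNReal.ofReal p + ENNReal.ofReal (p / Real.log 2) ≤
    ENNReal.ofReal (-Real.logb 2 q) * ENNReal.ofReal p + ENNReal.ofReal (q / Real.log 2) := by
  have h2 : 0 < Real.log 2 := Real.log_pos (by norm_num)
  rcases hp.eq_or_lt with rfl | hp0
  · simp
  have hlp : 0 ≤ -Real.logb 2 p := by
    have := Real.logb_nonpos (b := 2) (by norm_num) hp hp1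
    linarith
  have hlq : 0 ≤ -Real.logb 2 q := by
    have := Real.logb_nonpos (b := 2) (by norm_num) hq.le hq1
    linarith
  rw [← ENNReal.ofReal_mul hlp, ← ENNReal.ofReal_mul hlq, ← ENNReal.ofReal_add (by positivity) (by positivity),
    ← ENNReal.ofReal_add (by positivity) (by positivity)]
  apply ENNReal.ofReal_le_ofReal
  have h := Real.log_le_sub_one_of_pos (div_pos hq hp0)
  rw [Real.log_div hq.ne' hp0.ne'] at h
  have h' : p * (Real.log q - Real.log p) ≤ q - p := by
    calc p * (Real.log q - Real.log p) ≤ p * (q / p - 1) := by gcongr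
      _ = q - p := by field_simp
  simp only [Real.logb]
  rw [← sub_nonneg]
  have : -(Real.log q / Real.log 2) * p + q / Real.log 2 - (-(Real.log p / Real.log 2) * p + p / Real.log 2)
    = ((q - p) - p * (Real.log q - Real.log p)) / Real.log 2 := by
    field_simp
    ring
  rw [this]
  apply div_nonneg _ h2.le
  linarith

lemma diag_withDensity {𝒴 : Type*} [MeasurableSpace 𝒴] [MeasurableSingletonClass 𝒴]
    (ρ : Measure 𝒴) [IsProbabilityMeasure ρ] (S : Set 𝒴) (hS : S.Countable) (hρ : ρ Sᶜ = 0) :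
    ρ.map (fun y => (y, y)) =
      (ρ.prod ρ).withDensity (((fun y => (y, y)) '' S).indicator (fun p => (ρ {p.1})⁻¹)) := by
  have hD : ((fun y : 𝒴 => (y, y)) '' S).Countable := hS.image _
  set Dg := (fun y : 𝒴 => (y, y)) '' S with hDg
  have hmeas : Measurable (fun y : 𝒴 => (y, y)) := measurable_id.prodMk measurable_id
  ext A hA
  rw [withDensity_apply _ hA, lintegral_indicator hD.measurableSet, Measure.restrict_restrict hD.measurableSet]
  have hC : (Dg ∩ A).Countable := hD.mono Set.inter_subset_left
  rw [lintegral_countable _ hC]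
  have h1 : ρ.map (fun y => (y, y)) A = ρ.map (fun y => (y, y)) (Dg ∩ A) := by
    refine le_antisymm ?_ (measure_mono Set.inter_subset_right)
    calc ρ.map (fun y => (y, y)) A ≤ ρ.map (fun y => (y, y)) ((Dg ∩ A) ∪ Dgᶜ) := by
          apply measure_mono
          intro x hx
          by_cases h : x ∈ Dg
          · exact Or.inl ⟨h, hx⟩
          · exact Or.inr h
      _ ≤ _ := measure_union_le _ _
      _ = ρ.map (fun y => (y, y)) (Dg ∩ A) := by
          rw [Measure.map_apply hmeas hD.measurableSet.compl]
          have : ρ ((fun y : 𝒴 => (y, y)) ⁻¹' Dgᶜ) = 0 := by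
            refine measure_mono_null ?_ hρ
            intro y hy hyS
            exact hy ⟨y, hyS, rfl⟩
          rw [this, add_zero]
  rw [h1, ← setLIntegral_one, lintegral_countable _ hC]
  apply tsum_congr
  rintro ⟨⟨a, b⟩, ⟨y, hy, h⟩, h'⟩
  simp only [Prod.mk.injEq] at h
  obtain ⟨rfl, rfl⟩ := h
  simp only [one_mul]
  rw [Measure.map_apply hmeas (measurableSet_singleton _), ← Set.singleton_prod_singleton, Measure.prod_prod]
  have : (fun y : 𝒴 => (y, y)) ⁻¹' ({y} ×ˢ {y}) = {y} := by
    ext; simp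
  rw [this]
  by_cases h0 : ρ {y} = 0
  · simp [h0]
  · rw [← mul_assoc, ENNReal.inv_mul_cancel h0 (measure_ne_top _ _), one_mul]

lemma entBits_le {Ω 𝒴 ι : Type*} [MeasurableSpace Ω] [MeasurableSpace 𝒴] [MeasurableSingletonClass 𝒴]
    [MeasurableSpace ι] [MeasurableSingletonClass ι] [Countable ι]
    (μ : Measure Ω) [IsProbabilityMeasure μ] (W : Ω → ι) (hW : Measurable W) (g : ι → 𝒴)
    (q : ι → ℝ) (hq : ∀ i, 0 < q i) (hq1 : ∀ i, q i ≤ 1) (hqs : ∑' i, ENNReal.ofReal (q i) ≤ 1) :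
    entBits μ (fun ω => g (W ω)) ≤ ∫⁻ ω, ENNReal.ofReal (-Real.logb 2 (q (W ω))) ∂μ := by
  have hg : Measurable g := measurable_of_countable g
  set Y : Ω → 𝒴 := fun ω => g (W ω) with hYdef
  have hY : Measurable Y := hg.comp hW
  have hmeas : Measurable (fun y : 𝒴 => (y, y)) := measurable_id.prodMk measurable_id
  set τ := μ.map W with hτ
  haveI : IsProbabilityMeasure τ := Measure.isProbabilityMeasure_map hW.aemeasurable
  set ρ := μ.map Y with hρ
  haveI : IsProbabilityMeasure ρ := Measure.isProbabilityMeasure_map hY.aemeasurable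
  -- Gibbs
  have hA : ∫⁻ ω, ENNReal.ofReal (-Real.logb 2 (τ {W ω}).toReal) ∂μ
      ≤ ∫⁻ ω, ENNReal.ofReal (-Real.logb 2 (q (W ω))) ∂μ := by
    have e1 : ∀ F : ι → ℝ≥0∞, ∫⁻ ω, F (W ω) ∂μ = ∑' i, F i * τ {i} := by
      intro F
      rw [← lintegral_countable', hτ, lintegral_map (measurable_of_countable F) hW]
    rw [e1 (fun i => ENNReal.ofReal (-Real.logb 2 (τ {i}).toReal)), e1 (fun i => ENNReal.ofReal (-Real.logb 2 (q i)))]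
    have hl2 : 0 < Real.log 2 := Real.log_pos (by norm_num)
    have hsum : ∑' i, τ {i} = 1 := by
      have := e1 (fun _ => 1)
      simpa using this.symm
    have key : ∑' i, (ENNReal.ofReal (-Real.logb 2 (τ {i}).toReal) * τ {i} + ENNReal.ofReal ((τ {i}).toReal / Real.log 2))
        ≤ ∑' i, (ENNReal.ofReal (-Real.logb 2 (q i)) * τ {i} + ENNReal.ofReal (q i / Real.log 2)) := by
      apply ENNReal.tsum_le_tsum
      intro i
      have := gibbs_aux (τ {i}).toReal (q i) ENNReal.toReal_nonneg (hq i)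
        (ENNReal.toReal_le_of_le_ofReal zero_le_one (by simpa using prob_le_one)) (hq1 i)
      rwa [ENNReal.ofReal_toReal (measure_ne_top _ _)] at this
    rw [ENNReal.tsum_add, ENNReal.tsum_add] at key
    have s1 : ∑' i, ENNReal.ofReal ((τ {i}).toReal / Real.log 2) = ENNReal.ofReal (1 / Real.log 2) := by
      simp_rw [div_eq_mul_inv, ENNReal.ofReal_mul ENNReal.toReal_nonneg, ENNReal.ofReal_toReal (measure_ne_top τ _)]
      rw [ENNReal.tsum_mul_right, hsum]; simp
    have s2 : ∑' i, ENNReal.ofReal (q i / Real.log 2) ≤ ENNReal.ofReal (1 / Real.log 2) := by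
      simp_rw [div_eq_mul_inv, ENNReal.ofReal_mul (hq _).le]
      rw [ENNReal.tsum_mul_right, ENNReal.ofReal_mul zero_le_one, ENNReal.ofReal_one]
      gcongr
    rw [s1] at key
    exact (ENNReal.add_le_add_iff_right ENNReal.ofReal_ne_top).1 (key.trans (by gcongr))
  -- density
  have hS : (Set.range g).Countable := Set.countable_range g
  have hρS : ρ (Set.range g)ᶜ = 0 := by
    rw [hρ, Measure.map_apply hY hS.measurableSet.compl]
    convert measure_empty (μ := μ)
    ext ω; simp [hYdef]
  have hwd := diag_withDensity ρ _ hS hρS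
  set f : 𝒴 × 𝒴 → ℝ≥0∞ := ((fun y => (y, y)) '' (Set.range g)).indicator (fun p => (ρ {p.1})⁻¹) with hf
  have hfm : Measurable f := by
    have hD : ((fun y : 𝒴 => (y, y)) '' (Set.range g)).Countable := hS.image _
    have : f = fun p => ∑' i : ((fun y : 𝒴 => (y, y)) '' (Set.range g)),
        ({(i : 𝒴 × 𝒴)} : Set (𝒴 × 𝒴)).indicator (fun _ => (ρ {(i : 𝒴 × 𝒴).1})⁻¹) p := by
      ext p
      by_cases hp : p ∈ ((fun y : 𝒴 => (y, y)) '' (Set.range g))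
      · rw [tsum_eq_single ⟨p, hp⟩]
        · rw [hf, Set.indicator_of_mem hp]; simp
        · intro b hb
          apply Set.indicator_of_notMem
          intro h
          apply hb
          ext1
          exact h.symm
      · rw [hf, Set.indicator_of_notMem hp, eq_comm, ENNReal.tsum_eq_zero]
        rintro ⟨i, hi⟩
        apply Set.indicator_of_notMem
        rintro rfl
        exact hp hi
    rw [this]
    haveI := hD.to_subtype
    exact Measurable.ennreal_tsum fun i => measurable_const.indicator (measurableSet_singleton _)
  have hP : μ.map (fun ω => (Y ω, Y ω)) = ρ.map (fun y => (y, y)) := by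
    rw [hρ, Measure.map_map hmeas hY]; rfl
  set P := μ.map (fun ω => (Y ω, Y ω)) with hPdef
  haveI : IsProbabilityMeasure P := Measure.isProbabilityMeasure_map (hY.prodMk hY).aemeasurable
  have hac : P ≪ ρ.prod ρ := by
    rw [hP, hwd]; exact withDensity_absolutelyContinuous _ _
  have hrn : P.rnDeriv (ρ.prod ρ) =ᵐ[P] f := by
    apply hac.ae_eq
    rw [hP, hwd]
    exact Measure.rnDeriv_withDensity _ hfm
  have hrn' : ∀ᵐ ω ∂μ, P.rnDeriv (ρ.prod ρ) (Y ω, Y ω) = (ρ {Y ω})⁻¹ := by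
    have := ae_of_ae_map (hY.prodMk hY).aemeasurable hrn
    filter_upwards [this] with ω hω
    rw [hω, hf, Set.indicator_of_mem]
    exact ⟨Y ω, ⟨W ω, rfl⟩, rfl⟩
  have hpos : ∀ᵐ ω ∂μ, τ {W ω} ≠ 0 := by
    have : ∀ᵐ i ∂τ, τ {i} ≠ 0 := by
      rw [ae_iff_of_countable]; exact fun _ h => h
    exact ae_of_ae_map hW.aemeasurable this
  have hle : ∀ ω, τ {W ω} ≤ ρ {Y ω} := by
    intro ω
    rw [hτ, hρ, Measure.map_apply hW (measurableSet_singleton _), Measure.map_apply hY (measurableSet_singleton _)]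
    apply measure_mono
    intro ω' h
    simp only [Set.mem_preimage, Set.mem_singleton_iff, hYdef] at h ⊢
    rw [h]
  have hpt : ∀ᵐ ω ∂μ, 0 ≤ Real.logb 2 (P.rnDeriv (ρ.prod ρ) (Y ω, Y ω)).toReal ∧
      Real.logb 2 (P.rnDeriv (ρ.prod ρ) (Y ω, Y ω)).toReal ≤ -Real.logb 2 (τ {W ω}).toReal := by
    filter_upwards [hrn', hpos] with ω h1 h2
    have h3 := hle ω
    have h4 : 0 < (τ {W ω}).toReal := ENNReal.toReal_pos h2 (measure_ne_top _ _)
    have h5 : (τ {W ω}).toReal ≤ (ρ {Y ω}).toReal := ENNReal.toReal_mono (measure_ne_top _ _) h3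
    have h6 : (ρ {Y ω}).toReal ≤ 1 := ENNReal.toReal_le_of_le_ofReal zero_le_one (by simpa using prob_le_one)
    rw [h1, ENNReal.toReal_inv, Real.logb_inv]
    constructor
    · have := Real.logb_nonpos (b := 2) (by norm_num) (h4.le.trans h5) h6
      linarith
    · have := Real.logb_le_logb_of_le (b := 2) (by norm_num) h4 h5
      linarith
  have hmL : Measurable (fun p => Real.logb 2 (P.rnDeriv (ρ.prod ρ) p).toReal) := by
    unfold Real.logb
    exact (Real.measurable_log.comp (Measure.measurable_rnDeriv _ _).ennreal_toReal).div_const _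
  have hB : ∫⁻ p, ENNReal.ofReal (Real.logb 2 (P.rnDeriv (ρ.prod ρ) p).toReal) ∂P
      ≤ ∫⁻ ω, ENNReal.ofReal (-Real.logb 2 (q (W ω))) ∂μ := by
    refine le_trans ?_ hA
    rw [hPdef, lintegral_map hmL.ennreal_ofReal (hY.prodMk hY)]
    apply lintegral_mono_ae
    filter_upwards [hpt] with ω h
    exact ENNReal.ofReal_le_ofReal h.2
  have hnn : 0 ≤ᵐ[P] (fun p => Real.logb 2 (P.rnDeriv (ρ.prod ρ) p).toReal) := by
    have : ∀ᵐ p ∂(μ.map (fun ω => (Y ω, Y ω))), 0 ≤ Real.logb 2 (P.rnDeriv (ρ.prod ρ) p).toReal := by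
      rw [ae_map_iff (hY.prodMk hY).aemeasurable (measurableSet_le measurable_const hmL)]
      filter_upwards [hpt] with ω h using h.1
    exact this
  by_cases htop : ∫⁻ ω, ENNReal.ofReal (-Real.logb 2 (q (W ω))) ∂μ = ⊤
  · rw [htop]; exact le_top
  have hint : Integrable (fun p => Real.logb 2 (P.rnDeriv (ρ.prod ρ) p).toReal) P := by
    refine ⟨hmL.aestronglyMeasurable, ?_⟩
    rw [hasFiniteIntegral_iff_ofReal hnn]
    exact lt_of_le_of_lt hB (lt_top_iff_ne_top.2 htop)
  change klBits P (ρ.prod ρ) ≤ _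
  unfold klBits
  rw [if_pos ⟨hac, hint⟩, ofReal_integral_eq_lintegral_ofReal hint hnn]
  exact hB

/-- the levels of greedy rejection sampling -/
def lev {𝒴 : Type*} [MeasurableSpace 𝒴] (P : Measure 𝒴) (r : 𝒴 → ℝ) : ℕ → ℝ
  | 0 => 0
  | k + 1 => lev P r k + (1 - ∫ y, min (r y) (lev P r k) ∂P)

def sg {𝒴 : Type*} [MeasurableSpace 𝒴] (P : Measure 𝒴) (r : 𝒴 → ℝ) (k : ℕ) : ℝ :=
  1 - ∫ y, min (r y) (lev P r k) ∂P

lemma mullog_tangent (a b : ℝ) (ha : 0 < a) (hb : 0 ≤ b) :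
    a * Real.log a + (b - a) * (1 + Real.log a) ≤ b * Real.log b := by
  rcases hb.eq_or_lt with rfl | hb
  · simp; linarith
  have h := Real.log_le_sub_one_of_pos (div_pos ha hb)
  rw [Real.log_div ha.ne' hb.ne'] at h
  have h' : b * (Real.log a - Real.log b) ≤ a - b := by
    calc b * (Real.log a - Real.log b) ≤ b * (a / b - 1) := by gcongr
      _ = a - b := by field_simp
  linarith

lemma ent3 (m : ℝ) (h0 : 0 ≤ m) (h1 : m ≤ 1) :
    -((1 - m) * Real.log (1 - m)) + m * Real.log 2 - m * Real.log m ≤ Real.log 3 := by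
  have a := mullog_tangent (1/3) (1 - m) (by norm_num) (by linarith)
  have b := mullog_tangent (2/3) m (by norm_num) h0
  have e1 : Real.log (1/3) = - Real.log 3 := by rw [one_div, Real.log_inv]
  have e2 : Real.log (2/3) = Real.log 2 - Real.log 3 := Real.log_div (by norm_num) (by norm_num)
  rw [e1] at a
  rw [e2] at b
  linarith

section scalar
variable {𝒴 : Type*} [MeasurableSpace 𝒴] {P : Measure 𝒴} [IsProbabilityMeasure P] {r : 𝒴 → ℝ}

lemma lev_succ (k : ℕ) : lev P r (k + 1) = lev P r k + sg P r k := rfl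

lemma int_min (hri : Integrable r P) (c : ℝ) : Integrable (fun y => min (r y) c) P := hri.inf (integrable_const c)

lemma sg_nonneg (hri : Integrable r P) (hr1 : ∫ y, r y ∂P = 1) (k : ℕ) : 0 ≤ sg P r k := by
  unfold sg
  rw [sub_nonneg, ← hr1]
  exact integral_mono (int_min hri _) hri (fun y => min_le_left _ _)

lemma lev_mono (hri : Integrable r P) (hr1 : ∫ y, r y ∂P = 1) : Monotone (lev P r) := by
  apply monotone_nat_of_le_succ
  intro k
  rw [lev_succ]
  linarith [sg_nonneg hri hr1 k]

lemma lev_nonneg (hri : Integrable r P) (hr1 : ∫ y, r y ∂P = 1) (k : ℕ) : 0 ≤ lev P r k := lev_mono hri hr1 (Nat.zero_le k)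

lemma sg_anti (hri : Integrable r P) (hr1 : ∫ y, r y ∂P = 1) : Antitone (sg P r) := by
  intro i j hij
  unfold sg
  apply sub_le_sub_left
  exact integral_mono (int_min hri _) (int_min hri _) (fun y => min_le_min le_rfl (lev_mono hri hr1 hij))

lemma sg_zero (hr0 : ∀ y, 0 ≤ r y) : sg P r 0 = 1 := by
  unfold sg
  simp [lev, hr0]

lemma lev_one (hr0 : ∀ y, 0 ≤ r y) : lev P r 1 = 1 := by
  rw [lev_succ, sg_zero hr0]; simp [lev]

lemma lev_ge (hri : Integrable r P) (hr1 : ∫ y, r y ∂P = 1) (k : ℕ) : k * sg P r k ≤ lev P r k := by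
  induction k with
  | zero => simp [lev]
  | succ k ih =>
    rw [lev_succ]
    have := sg_anti hri hr1 (Nat.le_succ k)
    push_cast
    have h2 : (k : ℝ) * sg P r (k + 1) ≤ k * sg P r k := by gcongr
    simp only [Nat.succ_eq_add_one] at this
    linarith

lemma sg_tendsto (hri : Integrable r P) (hr1 : ∫ y, r y ∂P = 1) (ε : ℝ) (hε : 0 < ε) : ∃ k, sg P r k < ε := by
  by_contra! h
  have hL : Filter.Tendsto (lev P r) Filter.atTop Filter.atTop := by
    apply Filter.tendsto_atTop_mono (f := fun k : ℕ => (k : ℝ) * ε)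
    · intro k
      exact le_trans (by gcongr; exact h k) (lev_ge hri hr1 k)
    · exact Filter.Tendsto.atTop_mul_const hε tendsto_natCast_atTop_atTop
  have hG : Filter.Tendsto (fun k => ∫ y, min (r y) (lev P r k) ∂P) Filter.atTop (nhds (∫ y, r y ∂P)) := by
    apply tendsto_integral_of_dominated_convergence (fun y => ‖r y‖)
    · intro k; exact (int_min hri _).aestronglyMeasurable
    · exact hri.norm
    · intro k
      have : ∀ᵐ y ∂P, True := by simp
      filter_upwards with y
      rw [Real.norm_eq_abs, Real.norm_eq_abs, abs_le]
      have := lev_nonneg hri hr1 k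
      constructor
      · exact le_min (neg_abs_le _) (by linarith [abs_nonneg (r y)])
      · exact (min_le_left _ _).trans (le_abs_self _)
    · filter_upwards with y
      apply tendsto_const_nhds.congr'
      filter_upwards [hL.eventually_ge_atTop (r y)] with k hk
      rw [min_eq_left hk]
  rw [hr1] at hG
  have h3 := (tendsto_const_nhds (x := (1:ℝ))).sub hG
  have := ge_of_tendsto' h3 h
  linarith

/-- integral of `min r L_k * log` -/
def En (P : Measure 𝒴) (r : 𝒴 → ℝ) (k : ℕ) : ℝ :=
  ∫ y, min (r y) (lev P r k) * Real.log (min (r y) (lev P r k)) ∂P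

lemma int_En (hrm : Measurable r) (hr0 : ∀ y, 0 ≤ r y) (c : ℝ) (hc : 0 ≤ c) : Integrable (fun y => min (r y) c * Real.log (min (r y) c)) P := by
  obtain ⟨C, hC⟩ := (isCompact_Icc (a := (0:ℝ)) (b := c)).exists_bound_of_continuousOn
    Real.continuous_mul_log.continuousOn
  apply Integrable.of_bound (C := C)
  · exact (Real.continuous_mul_log.measurable.comp (hrm.min measurable_const)).aestronglyMeasurable
  · filter_upwards with y
    exact hC _ ⟨le_min (hr0 y) hc, min_le_right _ _⟩

lemma En_step (hrm : Measurable r) (hr0 : ∀ y, 0 ≤ r y) (hri : Integrable r P) (hr1 : ∫ y, r y ∂P = 1) (k : ℕ) (hk : 1 ≤ k) :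
    (sg P r k - sg P r (k + 1)) * (1 + Real.log (lev P r k)) ≤ En P r (k + 1) - En P r k := by
  have hL1 : 1 ≤ lev P r k := (lev_one (P := P) hr0) ▸ lev_mono hri hr1 hk
  have hLk := lev_mono hri hr1 (Nat.le_succ k)
  have e : sg P r k - sg P r (k + 1) = ∫ y, (min (r y) (lev P r (k+1)) - min (r y) (lev P r k)) ∂P := by
    rw [integral_sub (int_min hri _) (int_min hri _)]
    unfold sg; ring
  rw [e, ← integral_mul_const]
  unfold En
  rw [← integral_sub (int_En hrm hr0 _ (lev_nonneg hri hr1 _)) (int_En hrm hr0 _ (lev_nonneg hri hr1 _))]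
  apply integral_mono
  · exact ((int_min hri _).sub (int_min hri _)).mul_const _
  · exact (int_En hrm hr0 _ (lev_nonneg hri hr1 _)).sub (int_En hrm hr0 _ (lev_nonneg hri hr1 _))
  intro y
  dsimp only
  rcases le_total (r y) (lev P r k) with h | h
  · rw [min_eq_left h, min_eq_left (h.trans hLk)]; simp
  · rw [min_eq_right h]
    have := mullog_tangent (lev P r k) (min (r y) (lev P r (k+1))) (by linarith)
      (le_min (hr0 y) (lev_nonneg hri hr1 _))
    linarith

lemma cost_bound (hrm : Measurable r) (hr0 : ∀ y, 0 ≤ r y) (hri : Integrable r P) (hr1 : ∫ y, r y ∂P = 1) (hint : Integrable (fun y => r y * Real.log (r y)) P) (N : ℕ) :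
    ∑ k ∈ Finset.range N, (sg P r k - sg P r (k + 1)) * Real.log (k + 1) ≤
      ∫ y, r y * Real.log (r y) ∂P + Real.log 3 := by
  have hσ0 := fun k => sg_nonneg (P := P) hri hr1 k
  have hanti : ∀ k, sg P r (k + 1) ≤ sg P r k := fun k => sg_anti hri hr1 (Nat.le_succ k)
  have step : ∀ k : ℕ, 1 ≤ k → (sg P r k - sg P r (k + 1)) * Real.log (k + 1) ≤
      (En P r (k + 1) - En P r k) + (sg P r k - sg P r (k + 1)) * (Real.log 2 - 1)
      + ((sg P r k - sg P r k * Real.log (sg P r k)) -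
        (sg P r (k+1) - sg P r (k+1) * Real.log (sg P r (k+1)))) := by
    intro k hk
    have hE := En_step hrm hr0 hri hr1 k hk
    rcases (hσ0 k).eq_or_lt with h | h
    · have h' : sg P r (k + 1) = 0 := le_antisymm (h ▸ hanti k) (hσ0 _)
      rw [← h, h'] at hE ⊢
      simp at hE ⊢
      linarith
    · have hk0 : (1:ℝ) ≤ k := by exact_mod_cast hk
      have h1 : Real.log (k + 1) ≤ Real.log 2 + Real.log k := by
        rw [← Real.log_mul (by norm_num) (by linarith)]
        exact Real.log_le_log (by linarith) (by linarith)
      have h2 : Real.log k + Real.log (sg P r k) ≤ Real.log (lev P r k) := by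
        rw [← Real.log_mul (by linarith) h.ne']
        exact Real.log_le_log (by positivity) (lev_ge hri hr1 k)
      have h3 := mullog_tangent (sg P r k) (sg P r (k+1)) h (hσ0 _)
      have hp : 0 ≤ sg P r k - sg P r (k + 1) := sub_nonneg.2 (hanti k)
      have h4 : (sg P r k - sg P r (k + 1)) * Real.log (k + 1) ≤ (sg P r k - sg P r (k + 1)) *
        (Real.log 2 + Real.log (lev P r k) - Real.log (sg P r k)) := by
        gcongr; linarith
      linarith
  have hmain : ∀ N : ℕ, ∑ k ∈ Finset.range (N + 1), (sg P r k - sg P r (k + 1)) * Real.log (k + 1) ≤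
      (En P r (N + 1) - En P r 1) + (sg P r 1 - sg P r (N + 1)) * (Real.log 2 - 1)
      + ((sg P r 1 - sg P r 1 * Real.log (sg P r 1)) -
        (sg P r (N+1) - sg P r (N+1) * Real.log (sg P r (N+1)))) := by
    intro N
    induction N with
    | zero => simp
    | succ N ih =>
      rw [Finset.sum_range_succ]
      have := step (N + 1) (by omega)
      push_cast at this ⊢
      linarith
  have hE1 : (1 - sg P r 1) * Real.log (1 - sg P r 1) ≤ En P r 1 := by
    have h := Real.convexOn_mul_log.map_integral_le (μ := P) (f := fun y => min (r y) (lev P r 1))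
      Real.continuous_mul_log.continuousOn isClosed_Ici
      (by filter_upwards with y using le_min (hr0 y) (lev_nonneg hri hr1 _)) (int_min hri _)
      (int_En hrm hr0 _ (lev_nonneg hri hr1 _))
    have e : 1 - sg P r 1 = ∫ y, min (r y) (lev P r 1) ∂P := by unfold sg; ring
    rw [e]
    exact h
  have hEN : ∀ N, En P r (N + 1) ≤ ∫ y, r y * Real.log (r y) ∂P := by
    intro N
    unfold En
    apply integral_mono (int_En hrm hr0 _ (lev_nonneg hri hr1 _)) hint
    intro y
    have hL1 : 1 ≤ lev P r (N + 1) := (lev_one (P := P) hr0) ▸ lev_mono hri hr1 (Nat.succ_le_succ (Nat.zero_le N))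
    dsimp only
    rcases le_total (r y) (lev P r (N+1)) with h | h
    · rw [min_eq_left h]
    · rw [min_eq_right h]
      have := Real.log_nonneg hL1
      gcongr
      exact hr0 y
  have hσ1 : sg P r 1 ≤ 1 := (sg_zero (P := P) hr0) ▸ hanti 0
  have h3 := ent3 (sg P r 1) (hσ0 1) hσ1
  have hfin : ∀ N : ℕ, ∑ k ∈ Finset.range (N + 1), (sg P r k - sg P r (k + 1)) * Real.log (k + 1) ≤
      ∫ y, r y * Real.log (r y) ∂P + Real.log 3 := by
    intro N
    have h1 := hmain N
    have h2 := hEN N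
    have h4 : sg P r (N + 1) * Real.log (sg P r (N + 1)) ≤ 0 :=
      mul_nonpos_of_nonneg_of_nonpos (hσ0 _) (Real.log_nonpos (hσ0 _)
        ((sg_zero (P := P) hr0) ▸ sg_anti hri hr1 (Nat.zero_le _)))
    have h5 : 0 ≤ sg P r (N + 1) * Real.log 2 := mul_nonneg (hσ0 _) (Real.log_nonneg (by norm_num))
    linarith
  refine le_trans ?_ (hfin N)
  apply Finset.sum_le_sum_of_subset_of_nonneg
  · intro k; simp; omega
  · intro k _ _
    exact mul_nonneg (sub_nonneg.2 (hanti k)) (Real.log_nonneg (by linarith [Nat.cast_nonneg (α := ℝ) k]))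
end scalar

lemma rpow_tele (s : ℝ) (hs : 0 < s) (k : ℝ) (hk : 1 ≤ k) :
    s * (k + 1) ^ (-(1 + s)) ≤ k ^ (-s) - (k + 1) ^ (-s) := by
  have hk0 : 0 < k := by linarith
  have hk1 : 0 < k + 1 := by linarith
  have e1 : (k + 1) ^ (-(1 + s)) = (k + 1) ^ (-s) * (k + 1)⁻¹ := by
    rw [← Real.rpow_neg_one (k + 1), ← Real.rpow_add hk1]; congr 1; ring
  have e2 : k ^ (-s) = (k + 1) ^ (-s) * ((k + 1) / k) ^ s := by
    rw [Real.div_rpow hk1.le hk0.le, Real.rpow_neg hk1.le, Real.rpow_neg hk0.le]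
    have := Real.rpow_pos_of_pos hk1 s
    have := Real.rpow_pos_of_pos hk0 s
    field_simp
  have h : 1 + s * (k + 1)⁻¹ ≤ ((k + 1) / k) ^ s := by
    have hl : (k + 1)⁻¹ ≤ Real.log ((k + 1) / k) := by
      have := Real.log_le_sub_one_of_pos (div_pos hk0 hk1)
      have e : Real.log (k / (k + 1)) = - Real.log ((k + 1) / k) := by
        rw [← Real.log_inv, inv_div]
      rw [e] at this
      have e' : k / (k + 1) - 1 = - (k + 1)⁻¹ := by field_simp; ring
      rw [e'] at this
      linarith
    rw [Real.rpow_def_of_pos (div_pos hk1 hk0)]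
    have := Real.add_one_le_exp (Real.log ((k + 1) / k) * s)
    nlinarith
  have hp := Real.rpow_pos_of_pos hk1 (-s)
  rw [e1, e2]
  nlinarith

lemma zeta_bound (s : ℝ) (hs : 0 < s) (N : ℕ) :
    ∑ k ∈ Finset.range N, ((k : ℝ) + 1) ^ (-(1 + s)) ≤ 1 + 1 / s := by
  have h : ∀ N : ℕ, ∑ k ∈ Finset.range (N + 1), ((k : ℝ) + 1) ^ (-(1 + s)) ≤
      1 + (1 - ((N : ℝ) + 1) ^ (-s)) / s := by
    intro N
    induction N with
    | zero => simp
    | succ N ih =>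
      rw [Finset.sum_range_succ]
      have := rpow_tele s hs (N + 1) (by linarith [Nat.cast_nonneg (α := ℝ) N])
      push_cast
      have h2 : ((N:ℝ) + 1 + 1) ^ (-(1 + s)) ≤ (((N:ℝ) + 1) ^ (-s) - ((N:ℝ) + 1 + 1) ^ (-s)) / s := by
        rw [le_div_iff₀ hs]; linarith
      calc _ ≤ _ := add_le_add ih h2
        _ = _ := by ring
  calc _ ≤ ∑ k ∈ Finset.range (N + 1), ((k : ℝ) + 1) ^ (-(1 + s)) := by
        rw [Finset.sum_range_succ]
        have : 0 ≤ ((N:ℝ) + 1) ^ (-(1 + s)) := by positivity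
        linarith
    _ ≤ _ := h N
    _ ≤ _ := by
      have : 0 ≤ ((N:ℝ) + 1) ^ (-s) := by positivity
      gcongr
      linarith

/-- the universal code on the integers -/
def qc (m : ℝ) (k : ℕ) : ℝ := ((k : ℝ) + 1) ^ (-(1 + 1 / m)) / (1 + m)

lemma qc_pos (m : ℝ) (hm : 0 < m) (k : ℕ) : 0 < qc m k := by unfold qc; positivity

lemma qc_sum (m : ℝ) (hm : 0 < m) : ∑' k, ENNReal.ofReal (qc m k) ≤ 1 := by
  apply ENNReal.tsum_le_of_sum_range_le
  intro N
  rw [← ENNReal.ofReal_sum_of_nonneg (fun k _ => (qc_pos m hm k).le), ← ENNReal.ofReal_one]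
  apply ENNReal.ofReal_le_ofReal
  unfold qc
  rw [← Finset.sum_div, div_le_one (by linarith)]
  have := zeta_bound (1 / m) (by positivity) N
  simpa using this

lemma qc_log (m : ℝ) (hm : 0 < m) (k : ℕ) :
    -Real.logb 2 (qc m k) = (1 + 1 / m) * Real.logb 2 (k + 1) + Real.logb 2 (1 + m) := by
  unfold qc
  have : (0:ℝ) < (k:ℝ) + 1 := by positivity
  rw [Real.logb_div (by positivity) (by positivity), Real.logb_rpow_eq_mul_logb_of_pos this]
  ring

lemma two_point {Z : Type*} [MeasurableSpace Z] (P : Measure Z) [IsProbabilityMeasure P]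
    (u v : Z → ℝ) (hui : Integrable u P) (hvi : Integrable v P) (hvm : Measurable v)
    (hu : ∫ z, u z ∂P ≤ 0) (hv : ∫ z, v z ∂P = 0) (G : Z → Prop) (hG : ∀ᵐ z ∂P, G z) :
    ∃ z0 z1 t, 0 ≤ t ∧ t ≤ 1 ∧ G z0 ∧ G z1 ∧ t * u z0 + (1 - t) * u z1 ≤ 0 ∧
      t * v z0 + (1 - t) * v z1 ≤ 0 := by
  set A : Set Z := {z | 0 < v z} with hA
  have hAm : MeasurableSet A := measurableSet_lt measurable_const hvm
  by_cases hPA : P A = 0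
  · -- `v ≤ 0` a.e.
    have hv0 : ∀ᵐ z ∂P, v z ≤ 0 := by
      have : ∀ᵐ z ∂P, z ∉ A := measure_eq_zero_iff_ae_notMem.1 hPA
      filter_upwards [this] with z hz
      exact not_lt.1 hz
    by_contra! hcon
    have : ∀ᵐ z ∂P, 0 < u z := by
      filter_upwards [hv0, hG] with z h1 h2
      by_contra! h3
      have := hcon z z 1 zero_le_one le_rfl h2 h2 (by simpa using h3)
      simp at this
      linarith
    have hpos : 0 < ∫ z, u z ∂P := by
      rw [integral_pos_iff_support_of_nonneg_ae (by filter_upwards [this] with z hz using hz.le) hui]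
      have : P (Function.support u) = 1 := by
        rw [← prob_compl_eq_zero_iff₀]
        · apply measure_mono_null (t := {z | ¬ 0 < u z})
          · intro z hz; simp at hz ⊢; exact hz.le
          · exact this
        · exact hui.aestronglyMeasurable.aemeasurable.nullMeasurable (measurableSet_singleton 0).compl
      rw [this]; exact one_pos
    linarith
  · by_contra! hcon
    -- strict positivity for all pairs
    have hpair : ∀ z0 ∈ A, ∀ z1 ∉ A, G z0 → G z1 → 0 < (-v z1) * u z0 + v z0 * u z1 := by
      intro z0 h0 z1 h1 g0 g1
      have h0' : 0 < v z0 := h0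
      have h1' : v z1 ≤ 0 := not_lt.1 h1
      have hd : 0 < v z0 - v z1 := by linarith
      by_contra! hneg
      have e1 : -v z1 / (v z0 - v z1) * u z0 + (1 - -v z1 / (v z0 - v z1)) * u z1 =
        ((-v z1) * u z0 + v z0 * u z1) / (v z0 - v z1) := by field_simp; ring
      have e2 : -v z1 / (v z0 - v z1) * v z0 + (1 - -v z1 / (v z0 - v z1)) * v z1 = 0 := by field_simp; ring
      have := hcon z0 z1 (-v z1 / (v z0 - v z1)) (div_nonneg (by linarith) hd.le)
        (by rw [div_le_one hd]; linarith) g0 g1 (by rw [e1]; exact div_nonpos_of_nonpos_of_nonneg hneg hd.le)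
      rw [e2] at this
      exact lt_irrefl _ this
    set V := ∫ z in A, v z ∂P with hV
    set U := ∫ z in A, u z ∂P with hU
    have hpos1 : ∀ f : Z → ℝ, ∀ B : Set Z, MeasurableSet B → P B ≠ 0 → Integrable f P →
        (∀ᵐ z ∂P, z ∈ B → 0 < f z) → 0 < ∫ z in B, f z ∂P := by
      intro f B hB hPB hf hpos
      have hpos' : ∀ᵐ z ∂(P.restrict B), 0 < f z := (ae_restrict_iff' hB).2 hpos
      rw [integral_pos_iff_support_of_nonneg_ae (by filter_upwards [hpos'] with z hz using hz.le) hf.integrableOn]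
      have : P.restrict B (Function.support f)ᶜ = 0 := by
        apply measure_mono_null (t := {z | ¬ 0 < f z})
        · intro z hz; simp at hz ⊢; exact hz.le
        · exact hpos'
      rw [pos_iff_ne_zero]
      intro h0
      apply hPB
      rw [← Measure.restrict_apply_univ, ← Set.union_compl_self (Function.support f)]
      exact le_antisymm ((measure_union_le _ _).trans (by rw [h0, this, add_zero])) zero_le
    have hVpos : 0 < V := hpos1 v A hAm hPA hvi (Filter.Eventually.of_forall fun z hz => hz)
    have hVc : ∫ z in Aᶜ, v z ∂P = -V := by
      have := integral_add_compl hAm hvi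
      rw [hv] at this
      linarith
    have hUc : ∫ z in Aᶜ, u z ∂P ≤ -U := by
      have := integral_add_compl hAm hui
      linarith
    have hPAc : P Aᶜ ≠ 0 := by
      intro h0
      have : ∫ z in Aᶜ, v z ∂P = 0 := by rw [Measure.restrict_eq_zero.2 h0]; simp
      linarith
    have h1 : ∀ᵐ z1 ∂P, z1 ∈ Aᶜ → 0 < (-v z1) * U + V * u z1 := by
      filter_upwards [hG] with z1 g1 hz1
      have := hpos1 (fun z0 => (-v z1) * u z0 + v z0 * u z1) A hAm hPA
        ((hui.const_mul _).add (hvi.mul_const _)) (by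
          filter_upwards [hG] with z0 g0 hz0
          exact hpair z0 hz0 z1 hz1 g0 g1)
      rw [integral_add (hui.const_mul _).integrableOn (hvi.mul_const _).integrableOn,
        integral_const_mul, integral_mul_const] at this
      exact this
    have h2 := hpos1 (fun z1 => (-v z1) * U + V * u z1) Aᶜ hAm.compl hPAc
      ((hvi.neg.mul_const _).add (hui.const_mul _)) h1
    have hi1 : IntegrableOn (fun z1 => (-v z1) * U) Aᶜ P := (hvi.neg.mul_const _).integrableOn
    rw [integral_add hi1 (hui.const_mul _).integrableOn,
        integral_mul_const, integral_const_mul, integral_neg, hVc] at h2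
    nlinarith

/-- uniform law on `[0,1]` -/
def unif : Measure ℝ := volume.restrict (Set.Icc 0 1)

instance : IsProbabilityMeasure unif := ⟨by simp [unif]⟩

lemma unif_acc (s a : ℝ) (h0 : 0 ≤ a) (h1 : a ≤ s) :
    ENNReal.ofReal s * unif {u | u * s ≤ a} = ENNReal.ofReal a := by
  rcases (h0.trans h1).eq_or_lt with h | h
  · have : a = 0 := by linarith
    simp [← h, this]
  · have hms : MeasurableSet {u : ℝ | u * s ≤ a} := measurableSet_le (by fun_prop) measurable_const
    have e : {u : ℝ | u * s ≤ a} ∩ Set.Icc 0 1 = Set.Icc 0 (a / s) := by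
      ext u
      simp only [Set.mem_inter_iff, Set.mem_ofPred_eq, Set.mem_Icc, le_div_iff₀ h]
      constructor
      · rintro ⟨h1, h2, h3⟩; exact ⟨h2, h1⟩
      · rintro ⟨h2, h3⟩
        refine ⟨h3, h2, ?_⟩
        by_contra! hh
        nlinarith
    rw [unif, Measure.restrict_apply hms, e, Real.volume_Icc, ← ENNReal.ofReal_mul h.le]
    congr 1
    field_simp
    ring

/-- increment -/
def inc {𝒴 : Type*} [MeasurableSpace 𝒴] (P : Measure 𝒴) (r : 𝒴 → ℝ) (k : ℕ) (y : 𝒴) : ℝ :=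
  min (r y) (lev P r (k + 1)) - min (r y) (lev P r k)

/-- acceptance region at step `k` -/
def accR {𝒴 : Type*} [MeasurableSpace 𝒴] (P : Measure 𝒴) (r : 𝒴 → ℝ) (k : ℕ) : Set (𝒴 × ℝ) :=
  {p | p.2 * sg P r k ≤ inc P r k p.1}

open Classical in
/-- the index which is selected -/
def selK {𝒴 : Type*} [MeasurableSpace 𝒴] (P : Measure 𝒴) (r : 𝒴 → ℝ) (z : ℕ → 𝒴 × ℝ) : ℕ :=
  if h : ∃ k, z k ∈ accR P r k then Nat.find h else 0

lemma inc_sum {𝒴 : Type*} [MeasurableSpace 𝒴] (P : Measure 𝒴) (r : 𝒴 → ℝ) (hr0 : ∀ y, 0 ≤ r y) (y : 𝒴) (N : ℕ) :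
    ∑ k ∈ Finset.range N, inc P r k y = min (r y) (lev P r N) := by
  unfold inc
  rw [Finset.sum_range_sub (fun k => min (r y) (lev P r k))]
  simp [lev, hr0]

section sampling
variable {𝒴 : Type*} [MeasurableSpace 𝒴] {P : Measure 𝒴} [IsProbabilityMeasure P] {r : 𝒴 → ℝ}

lemma inc_nonneg (hri : Integrable r P) (hr1 : ∫ y, r y ∂P = 1) (k : ℕ) (y : 𝒴) : 0 ≤ inc P r k y :=
  sub_nonneg.2 (min_le_min le_rfl (lev_mono hri hr1 (Nat.le_succ k)))

lemma inc_le (hri : Integrable r P) (hr1 : ∫ y, r y ∂P = 1) (k : ℕ) (y : 𝒴) : inc P r k y ≤ sg P r k := by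
  unfold inc
  rw [lev_succ]
  have := sg_nonneg hri hr1 k
  rcases min_cases (r y) (lev P r k) with h | h <;>
    rcases min_cases (r y) (lev P r k + sg P r k) with h' | h' <;> linarith

lemma inc_meas (hrm : Measurable r) (k : ℕ) : Measurable (inc P r k) :=
  (hrm.min measurable_const).sub (hrm.min measurable_const)

lemma inc_int (hri : Integrable r P) (k : ℕ) : ∫ y, inc P r k y ∂P = sg P r k - sg P r (k + 1) := by
  unfold inc
  rw [integral_sub (int_min hri _) (int_min hri _)]
  unfold sg; ring

lemma inc_lint (hri : Integrable r P) (hr1 : ∫ y, r y ∂P = 1) (k : ℕ) : ∫⁻ y, ENNReal.ofReal (inc P r k y) ∂P = ENNReal.ofReal (sg P r k - sg P r (k + 1)) := by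
  rw [← inc_int hri, ofReal_integral_eq_lintegral_ofReal]
  · exact (int_min hri _).sub (int_min hri _)
  · filter_upwards with y using inc_nonneg hri hr1 k y

lemma accR_meas (hrm : Measurable r) (k : ℕ) : MeasurableSet (accR P r k) :=
  measurableSet_le (measurable_snd.mul_const _) ((inc_meas hrm k).comp measurable_fst)

lemma accR_prob (hrm : Measurable r) (hri : Integrable r P) (hr1 : ∫ y, r y ∂P = 1) (k : ℕ) (A : Set 𝒴) (hA : MeasurableSet A) :
    ENNReal.ofReal (sg P r k) * (P.prod unif) (accR P r k ∩ Prod.fst ⁻¹' A) =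
      ∫⁻ y in A, ENNReal.ofReal (inc P r k y) ∂P := by
  rw [Measure.prod_apply ((accR_meas hrm k).inter (measurable_fst hA)),
    ← lintegral_const_mul' _ _ ENNReal.ofReal_ne_top, ← lintegral_indicator hA]
  apply lintegral_congr
  intro y
  by_cases hy : y ∈ A
  · rw [Set.indicator_of_mem hy, ← unif_acc (sg P r k) _ (inc_nonneg hri hr1 k y) (inc_le hri hr1 k y)]
    congr 2
    ext u
    simp [accR, hy]
  · rw [Set.indicator_of_notMem hy]
    have : Prod.mk y ⁻¹' (accR P r k ∩ Prod.fst ⁻¹' A) = (∅ : Set ℝ) := by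
      ext u; simp [hy]
    rw [this]; simp

lemma rej_prob (hrm : Measurable r) (hri : Integrable r P) (hr1 : ∫ y, r y ∂P = 1) (k : ℕ) :
    ENNReal.ofReal (sg P r k) * (P.prod unif) (accR P r k)ᶜ = ENNReal.ofReal (sg P r (k + 1)) := by
  have h := accR_prob hrm hri hr1 k Set.univ MeasurableSet.univ
  rw [Set.preimage_univ, Set.inter_univ, Measure.restrict_univ, inc_lint hri hr1] at h
  rw [prob_compl_eq_one_sub (accR_meas hrm k), ENNReal.mul_sub (fun _ _ => ENNReal.ofReal_ne_top), h, mul_one,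
    ← ENNReal.ofReal_sub _ (sub_nonneg.2 (sg_anti hri hr1 (Nat.le_succ k)))]
  congr 1; ring

lemma rej_prod (hrm : Measurable r) (hr0 : ∀ y, 0 ≤ r y) (hri : Integrable r P) (hr1 : ∫ y, r y ∂P = 1) (k : ℕ) :
    ∏ i ∈ Finset.range k, (P.prod unif) (accR P r i)ᶜ = ENNReal.ofReal (sg P r k) := by
  induction k with
  | zero => simp [sg_zero hr0]
  | succ k ih => rw [Finset.prod_range_succ, ih, rej_prob hrm hri hr1]

/-- law of the common randomness -/
def PZ (P : Measure 𝒴) [IsProbabilityMeasure P] : Measure (ℕ → 𝒴 × ℝ) := Measure.infinitePi (fun _ => P.prod unif)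

instance : IsProbabilityMeasure (PZ P) := by unfold PZ; infer_instance

def boxS (P : Measure 𝒴) (r : 𝒴 → ℝ) (k : ℕ) : Set (ℕ → 𝒴 × ℝ) :=
  {z | (∀ i < k, z i ∉ accR P r i) ∧ z k ∈ accR P r k}

lemma boxS_meas (hrm : Measurable r) (k : ℕ) : MeasurableSet (boxS P r k) := by
  have : boxS P r k = (⋂ i, ⋂ (_ : i < k), (fun z : ℕ → 𝒴 × ℝ => z i) ⁻¹' (accR P r i)ᶜ) ∩ (fun z => z k) ⁻¹' (accR P r k) := by
    ext z; simp [boxS]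
  rw [this]
  apply MeasurableSet.inter
  · exact MeasurableSet.iInter fun i => MeasurableSet.iInter fun _ => measurable_pi_apply i (accR_meas hrm i).compl
  · exact measurable_pi_apply k (accR_meas hrm k)

lemma box_prob (hrm : Measurable r) (hr0 : ∀ y, 0 ≤ r y) (hri : Integrable r P) (hr1 : ∫ y, r y ∂P = 1) (k : ℕ) (A : Set 𝒴) (hA : MeasurableSet A) :
    PZ P ((fun z => (z k).1) ⁻¹' A ∩ boxS P r k) = ∫⁻ y in A, ENNReal.ofReal (inc P r k y) ∂P := by
  have e : (fun z : ℕ → 𝒴 × ℝ => (z k).1) ⁻¹' A ∩ boxS P r k =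
      Set.pi (Finset.range (k + 1)) (fun i => if i < k then (accR P r i)ᶜ else accR P r k ∩ Prod.fst ⁻¹' A) := by
    ext z
    simp only [boxS, Set.mem_inter_iff, Set.mem_preimage, Set.mem_ofPred_eq, Set.mem_pi, Finset.coe_range, Set.mem_Iio]
    constructor
    · rintro ⟨h1, h2, h3⟩ i hi
      split_ifs with h
      · exact h2 i h
      · have : i = k := by omega
        subst this
        exact ⟨h3, h1⟩
    · intro h
      have hk := h k (by omega)
      simp only [lt_irrefl, if_false] at hk
      refine ⟨hk.2, fun i hi => ?_, hk.1⟩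
      have := h i (by omega)
      simpa [hi] using this
  rw [e, PZ, Measure.infinitePi_pi]
  · rw [Finset.prod_range_succ, ← accR_prob hrm hri hr1 k A hA, ← rej_prod hrm hr0 hri hr1]
    congr 1
    · apply Finset.prod_congr rfl
      intro i hi
      rw [if_pos (Finset.mem_range.1 hi)]
    · simp
  · intro i _
    split_ifs
    · exact (accR_meas hrm i).compl
    · exact (accR_meas hrm k).inter (measurable_fst hA)

lemma fail_prob (hrm : Measurable r) (hr0 : ∀ y, 0 ≤ r y) (hri : Integrable r P) (hr1 : ∫ y, r y ∂P = 1) : ∀ᵐ z ∂(PZ P), ∃ k, z k ∈ accR P r k := by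
  rw [ae_iff]
  apply le_antisymm _ zero_le
  apply le_of_forall_pos_le_add
  intro ε hε
  rw [zero_add]
  by_cases hεt : ε = ⊤
  · rw [hεt]; exact le_top
  obtain ⟨k, hk⟩ := sg_tendsto (P := P) hri hr1 ε.toReal (ENNReal.toReal_pos hε.ne' hεt)
  calc PZ P {z | ¬ ∃ k, z k ∈ accR P r k} ≤ PZ P (Set.pi (Finset.range k) (fun i => (accR P r i)ᶜ)) := by
        apply measure_mono
        intro z hz i _ hi
        exact hz ⟨i, hi⟩
    _ = ENNReal.ofReal (sg P r k) := by
        rw [PZ, Measure.infinitePi_pi _ (fun i _ => (accR_meas hrm i).compl), rej_prod hrm hr0 hri hr1]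
    _ ≤ ε := ENNReal.ofReal_le_of_le_toReal hk.le

lemma sel_lint (hrm : Measurable r) (hr0 : ∀ y, 0 ≤ r y) (hri : Integrable r P) (hr1 : ∫ y, r y ∂P = 1) (F : ℕ → 𝒴 → ℝ≥0∞) (hF : ∀ k, Measurable (F k)) :
    ∫⁻ z, F (selK P r z) (z (selK P r z)).1 ∂(PZ P) ≤
      ∑' k, ∫⁻ y, F k y * ENNReal.ofReal (inc P r k y) ∂P := by
  classical
  have h1 : ∀ᵐ z ∂(PZ P), F (selK P r z) (z (selK P r z)).1 ≤
      ∑' k, (boxS P r k).indicator (fun z => F k (z k).1) z := by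
    filter_upwards [fail_prob hrm hr0 hri hr1] with z hz
    have hs : selK P r z = Nat.find hz := by rw [selK, dif_pos hz]
    refine le_trans ?_ (ENNReal.le_tsum (selK P r z))
    rw [Set.indicator_of_mem]
    rw [hs]
    exact ⟨fun i hi => Nat.find_min hz hi, Nat.find_spec hz⟩
  have hmk : ∀ k, Measurable (fun z : ℕ → 𝒴 × ℝ => (z k).1) := fun k => (measurable_pi_apply k).fst
  refine (lintegral_mono_ae h1).trans ?_
  have hms : ∀ k, AEMeasurable ((boxS P r k).indicator (fun z => F k (z k).1)) (PZ P) := fun k =>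
    (((hF k).comp (hmk k)).indicator (boxS_meas hrm k)).aemeasurable
  rw [lintegral_tsum hms]
  apply ENNReal.tsum_le_tsum
  intro k
  rw [lintegral_indicator (boxS_meas hrm k)]
  have hmap : ((PZ P).restrict (boxS P r k)).map (fun z => (z k).1) =
      P.withDensity (fun y => ENNReal.ofReal (inc P r k y)) := by
    ext A hA
    rw [Measure.map_apply (hmk k) hA, Measure.restrict_apply (hmk k hA), withDensity_apply _ hA,
      box_prob hrm hr0 hri hr1 k A hA]
  rw [← lintegral_map (hF k) (hmk k), hmap, lintegral_withDensity_eq_lintegral_mul _ (inc_meas hrm k).ennreal_ofReal (hF k)]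
  apply le_of_eq
  apply lintegral_congr
  intro y
  simp [mul_comm]
end sampling

lemma cost_enn {𝒴 : Type*} [MeasurableSpace 𝒴] {P : Measure 𝒴} [IsProbabilityMeasure P] {r : 𝒴 → ℝ}
    (hrm : Measurable r) (hr0 : ∀ y, 0 ≤ r y) (hri : Integrable r P) (hr1 : ∫ y, r y ∂P = 1)
    (hint : Integrable (fun y => r y * Real.log (r y)) P) (m : ℝ) (hm : 0 < m) :
    ∑' k, ENNReal.ofReal (-Real.logb 2 (qc m k)) * ENNReal.ofReal (sg P r k - sg P r (k + 1)) ≤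
      ENNReal.ofReal ((1 + 1 / m) * ((∫ y, r y * Real.log (r y) ∂P + Real.log 3) / Real.log 2)
        + Real.logb 2 (1 + m)) := by
  apply ENNReal.tsum_le_of_sum_range_le
  intro N
  have hp : ∀ k, 0 ≤ sg P r k - sg P r (k + 1) := fun k => sub_nonneg.2 (sg_anti hri hr1 (Nat.le_succ k))
  have h2 : 0 < Real.log 2 := Real.log_pos (by norm_num)
  have hl : 0 ≤ Real.logb 2 (1 + m) := Real.logb_nonneg (by norm_num) (by linarith)
  have hnn : ∀ k, 0 ≤ -Real.logb 2 (qc m k) := by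
    intro k
    rw [qc_log m hm]
    have : 0 ≤ Real.logb 2 ((k:ℝ) + 1) := Real.logb_nonneg (by norm_num) (by linarith [Nat.cast_nonneg (α := ℝ) k])
    positivity
  simp_rw [← ENNReal.ofReal_mul (hnn _)]
  rw [← ENNReal.ofReal_sum_of_nonneg (fun k _ => mul_nonneg (hnn k) (hp k))]
  apply ENNReal.ofReal_le_ofReal
  have e : ∀ k : ℕ, -Real.logb 2 (qc m k) * (sg P r k - sg P r (k + 1)) =
      (1 + 1 / m) * (((sg P r k - sg P r (k + 1)) * Real.log (k + 1)) / Real.log 2) +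
      Real.logb 2 (1 + m) * (sg P r k - sg P r (k + 1)) := by
    intro k
    rw [qc_log m hm]
    simp only [Real.logb]
    ring
  simp_rw [e]
  rw [Finset.sum_add_distrib, ← Finset.mul_sum, ← Finset.sum_div, ← Finset.mul_sum, Finset.sum_range_sub']
  have hb := cost_bound hrm hr0 hri hr1 hint N
  have h0 := sg_zero (P := P) hr0
  have hN := sg_nonneg hri hr1 N
  have : Real.logb 2 (1 + m) * (sg P r 0 - sg P r N) ≤ Real.logb 2 (1 + m) := by
    rw [h0]; nlinarith
  gcongr

lemma two_point_enn {Z : Type*} [MeasurableSpace Z] (P : Measure Z) [IsProbabilityMeasure P]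
    (h δ : Z → ℝ≥0∞) (hh : Measurable h) (hδ : Measurable δ) (A D : ℝ≥0∞) (hA : A ≠ ⊤)
    (h1 : ∫⁻ z, h z ∂P ≤ A) (h2 : ∫⁻ z, δ z ∂P ≤ D) :
    ∃ z0 z1 t, 0 ≤ t ∧ t ≤ 1 ∧ ENNReal.ofReal t * h z0 + ENNReal.ofReal (1 - t) * h z1 ≤ A ∧
      ENNReal.ofReal t * δ z0 + ENNReal.ofReal (1 - t) * δ z1 ≤ D := by
  by_cases hD : D = ⊤
  · obtain ⟨z, hz⟩ := exists_le_lintegral (μ := P) hh.aemeasurable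
    refine ⟨z, z, 1, zero_le_one, le_rfl, ?_, by rw [hD]; exact le_top⟩
    simpa using hz.trans h1
  have f1 : ∫⁻ z, h z ∂P ≠ ⊤ := ne_top_of_le_ne_top hA h1
  have f2 : ∫⁻ z, δ z ∂P ≠ ⊤ := ne_top_of_le_ne_top hD h2
  have a1 := ae_lt_top hh f1
  have a2 := ae_lt_top hδ f2
  have i1 := integrable_toReal_of_lintegral_ne_top hh.aemeasurable f1
  have i2 := integrable_toReal_of_lintegral_ne_top hδ.aemeasurable f2
  have e1 := integral_toReal hh.aemeasurable a1
  have e2 := integral_toReal hδ.aemeasurable a2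
  obtain ⟨z0, z1, t, t0, t1, g0, g1, c1, c2⟩ := two_point P (fun z => (h z).toReal - A.toReal)
    (fun z => (δ z).toReal - (∫⁻ z, δ z ∂P).toReal) (i1.sub (integrable_const _)) (i2.sub (integrable_const _))
    (hδ.ennreal_toReal.sub_const _)
    (by rw [integral_sub i1 (integrable_const _), e1]; simpa using ENNReal.toReal_mono hA h1)
    (by rw [integral_sub i2 (integrable_const _), e2]; simp)
    (fun z => h z < ⊤ ∧ δ z < ⊤) (by filter_upwards [a1, a2] with z b1 b2 using ⟨b1, b2⟩)
  have key : ∀ a b : ℝ≥0∞, a < ⊤ → b < ⊤ → ENNReal.ofReal t * a + ENNReal.ofReal (1 - t) * b =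
      ENNReal.ofReal (t * a.toReal + (1 - t) * b.toReal) := by
    intro a b ha hb
    rw [ENNReal.ofReal_add (mul_nonneg t0 ENNReal.toReal_nonneg) (mul_nonneg (by linarith) ENNReal.toReal_nonneg),
      ENNReal.ofReal_mul t0, ENNReal.ofReal_mul (by linarith), ENNReal.ofReal_toReal ha.ne, ENNReal.ofReal_toReal hb.ne]
  refine ⟨z0, z1, t, t0, t1, ?_, ?_⟩
  · rw [key _ _ g0.1 g1.1]
    apply ENNReal.ofReal_le_of_le_toReal
    linarith
  · rw [key _ _ g0.2 g1.2]
    refine le_trans ?_ h2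
    apply ENNReal.ofReal_le_of_le_toReal
    linarith

section joint
variable {𝒳 𝒴 : Type*} [MeasurableSpace 𝒳] [MeasurableSpace 𝒴] (P : Measure 𝒴) [IsProbabilityMeasure P]
  (r : 𝒳 × 𝒴 → ℝ)

lemma lev_meas (hr : Measurable r) (k : ℕ) : Measurable (fun x => lev P (fun y => r (x, y)) k) := by
  induction k with
  | zero => exact measurable_const
  | succ k ih =>
    simp only [lev]
    have h : Measurable (fun p : 𝒳 × 𝒴 => min (r p) (lev P (fun y => r (p.1, y)) k)) := hr.min (ih.comp measurable_fst)
    exact ih.add (measurable_const.sub (h.stronglyMeasurable.integral_prod_right' (ν := P)).measurable)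

lemma sg_meas (hr : Measurable r) (k : ℕ) : Measurable (fun x => sg P (fun y => r (x, y)) k) := by
  have h : Measurable (fun p : 𝒳 × 𝒴 => min (r p) (lev P (fun y => r (p.1, y)) k)) :=
    hr.min ((lev_meas P r hr k).comp measurable_fst)
  exact (measurable_const.sub (h.stronglyMeasurable.integral_prod_right' (ν := P)).measurable)

lemma acc_meas_joint (hr : Measurable r) (k : ℕ) :
    MeasurableSet {p : 𝒳 × (ℕ → 𝒴 × ℝ) | p.2 k ∈ accR P (fun y => r (p.1, y)) k} := by
  have hz : Measurable (fun p : 𝒳 × (ℕ → 𝒴 × ℝ) => p.2 k) := (measurable_pi_apply k).comp measurable_snd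
  have hrr : Measurable (fun p : 𝒳 × (ℕ → 𝒴 × ℝ) => r (p.1, (p.2 k).1)) := hr.comp (measurable_fst.prodMk hz.fst)
  change MeasurableSet {p : 𝒳 × (ℕ → 𝒴 × ℝ) | (p.2 k).2 * sg P (fun y => r (p.1, y)) k ≤
    min (r (p.1, (p.2 k).1)) (lev P (fun y => r (p.1, y)) (k + 1)) -
      min (r (p.1, (p.2 k).1)) (lev P (fun y => r (p.1, y)) k)}
  apply measurableSet_le
  · exact hz.snd.mul ((sg_meas P r hr k).comp measurable_fst)
  · exact (hrr.min ((lev_meas P r hr (k+1)).comp measurable_fst)).sub (hrr.min ((lev_meas P r hr k).comp measurable_fst))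

lemma selK_meas (hr : Measurable r) : Measurable (fun p : 𝒳 × (ℕ → 𝒴 × ℝ) => selK P (fun y => r (p.1, y)) p.2) := by
  classical
  have hm := acc_meas_joint P r hr
  apply measurable_to_countable'
  intro k
  have : (fun p : 𝒳 × (ℕ → 𝒴 × ℝ) => selK P (fun y => r (p.1, y)) p.2) ⁻¹' {k} =
    ({p | p.2 k ∈ accR P (fun y => r (p.1, y)) k} ∩
      ⋂ i, ⋂ (_ : i < k), {p | p.2 i ∈ accR P (fun y => r (p.1, y)) i}ᶜ) ∪
    ((⋂ i, {p | p.2 i ∈ accR P (fun y => r (p.1, y)) i}ᶜ) ∩ {_p | k = 0}) := by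
    ext p
    simp only [Set.mem_preimage, Set.mem_singleton_iff, Set.mem_union, Set.mem_inter_iff, Set.mem_iInter,
      Set.mem_compl_iff, Set.mem_ofPred_eq]
    unfold selK
    split_ifs with h
    · rw [Nat.find_eq_iff]
      constructor
      · intro h'; exact Or.inl h'
      · rintro (h' | h')
        · exact h'
        · obtain ⟨j, hj⟩ := h
          exact absurd hj (h'.1 j)
    · push Not at h
      constructor
      · intro h'; exact Or.inr ⟨h, h'.symm⟩
      · rintro (h' | h')
        · exact absurd h'.1 (h k)
        · exact h'.2.symm
  rw [this]
  refine ((hm k).inter (MeasurableSet.iInter fun i => MeasurableSet.iInter fun _ => (hm i).compl)).union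
    ((MeasurableSet.iInter fun i => (hm i).compl).inter (MeasurableSet.const _))

lemma selY_meas (hr : Measurable r) : Measurable (fun p : 𝒳 × (ℕ → 𝒴 × ℝ) => (p.2 (selK P (fun y => r (p.1, y)) p.2)).1) := by
  have h : Measurable (fun q : ℕ × (ℕ → 𝒴 × ℝ) => (q.2 q.1).1) :=
    measurable_from_prod_countable_right (fun k => (measurable_pi_apply k).fst)
  exact h.comp ((selK_meas P r hr).prodMk measurable_snd)
end joint

lemma mi_unfold {𝒳 𝒴 : Type*} [MeasurableSpace 𝒳] [MeasurableSpace 𝒴] (ν : Measure (𝒳 × 𝒴))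
    (hfin : miOfJoint ν ≠ ⊤) :
    ν ≪ ν.fst.prod ν.snd ∧
    Integrable (fun p => Real.logb 2 (ν.rnDeriv (ν.fst.prod ν.snd) p).toReal) ν ∧
    ∫ p, Real.logb 2 (ν.rnDeriv (ν.fst.prod ν.snd) p).toReal ∂ν ≤ (miOfJoint ν).toReal := by
  have e : miOfJoint ν = klBits ν (ν.fst.prod ν.snd) := by
    unfold miOfJoint miBits
    have : (fun ω : 𝒳 × 𝒴 => (ω.1, ω.2)) = id := rfl
    rw [this, Measure.map_id]; rfl
  rw [e] at hfin ⊢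
  unfold klBits at hfin ⊢
  split_ifs at hfin ⊢ with h
  · refine ⟨h.1, h.2, ?_⟩
    rw [ENNReal.toReal_ofReal']
    exact le_max_left _ _
  · exact absurd rfl hfin

lemma density_facts {𝒳 𝒴 : Type*} [MeasurableSpace 𝒳] [MeasurableSpace 𝒴] (ν : Measure (𝒳 × 𝒴))
    [IsProbabilityMeasure ν] (hac : ν ≪ ν.fst.prod ν.snd) :
    ∀ᵐ x ∂ν.fst, Integrable (fun y => (ν.rnDeriv (ν.fst.prod ν.snd) (x, y)).toReal) ν.snd ∧
      ∫ y, (ν.rnDeriv (ν.fst.prod ν.snd) (x, y)).toReal ∂ν.snd = 1 := by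
  set R := ν.rnDeriv (ν.fst.prod ν.snd) with hR
  have hRm : Measurable R := Measure.measurable_rnDeriv _ _
  have hw : (ν.fst.prod ν.snd).withDensity R = ν := Measure.withDensity_rnDeriv_eq _ _ hac
  have hlt : ∀ᵐ p ∂(ν.fst.prod ν.snd), R p < ⊤ := Measure.rnDeriv_lt_top _ _
  have hlt' := Measure.ae_ae_of_ae_prod hlt
  have hone : (fun x => ∫⁻ y, R (x, y) ∂ν.snd) =ᵐ[ν.fst] fun _ => 1 := by
    rw [← withDensity_eq_iff_of_sigmaFinite hRm.lintegral_prod_right'.aemeasurable aemeasurable_const]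
    ext A hA
    rw [withDensity_apply _ hA, withDensity_apply _ hA, setLIntegral_one, Measure.fst_apply hA]
    conv_rhs => rw [← hw]
    rw [withDensity_apply _ (measurable_fst hA), ← Set.prod_univ, ← Measure.prod_restrict, lintegral_prod _ hRm.aemeasurable]
    simp
  filter_upwards [hlt', hone] with x h1 h2
  have hm : Measurable (fun y => R (x, y)) := hRm.comp measurable_prodMk_left
  refine ⟨integrable_toReal_of_lintegral_ne_top hm.aemeasurable (by rw [h2]; simp), ?_⟩
  rw [integral_toReal hm.aemeasurable h1, h2]; simp

lemma exists_codes {𝒳 𝒴 : Type*} [MeasurableSpace 𝒳] [MeasurableSpace 𝒴] (ν : Measure (𝒳 × 𝒴))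
    [IsProbabilityMeasure ν] (hfin : miOfJoint ν ≠ ⊤) (d : 𝒳 × 𝒴 → ℝ≥0∞) (hd : Measurable d) (D : ℝ≥0∞)
    (hdist : ∫⁻ p, d p ∂ν ≤ D) (m : ℝ) (hm0 : 0 < m) (hm : m = (miOfJoint ν).toReal + Real.logb 2 3) :
    ∃ (r : 𝒳 × 𝒴 → ℝ) (_ : Measurable r) (z0 z1 : ℕ → 𝒴 × ℝ) (t : ℝ), 0 ≤ t ∧ t ≤ 1 ∧
      ENNReal.ofReal t * ∫⁻ x, ENNReal.ofReal (-Real.logb 2 (qc m (selK ν.snd (fun y => r (x, y)) z0))) ∂ν.fst +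
      ENNReal.ofReal (1 - t) * ∫⁻ x, ENNReal.ofReal (-Real.logb 2 (qc m (selK ν.snd (fun y => r (x, y)) z1))) ∂ν.fst
        ≤ ENNReal.ofReal (m + 1 + Real.logb 2 (1 + m)) ∧
      ENNReal.ofReal t * ∫⁻ x, d (x, (z0 (selK ν.snd (fun y => r (x, y)) z0)).1) ∂ν.fst +
      ENNReal.ofReal (1 - t) * ∫⁻ x, d (x, (z1 (selK ν.snd (fun y => r (x, y)) z1)).1) ∂ν.fst ≤ D := by
  obtain ⟨hac, hint, hI⟩ := mi_unfold ν hfin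
  have hfacts := density_facts ν hac
  set R := ν.rnDeriv (ν.fst.prod ν.snd) with hR
  have hRm : Measurable R := Measure.measurable_rnDeriv _ _
  have hw : (ν.fst.prod ν.snd).withDensity R = ν := Measure.withDensity_rnDeriv_eq _ _ hac
  set r : 𝒳 × 𝒴 → ℝ := fun p => (R p).toReal with hrdef
  have hr : Measurable r := hRm.ennreal_toReal
  have hl2 : 0 < Real.log 2 := Real.log_pos (by norm_num)
  -- entropy integrals
  have hintl : Integrable (fun p => Real.log (r p)) ν := by
    have := hint.mul_const (Real.log 2)
    refine this.congr (Filter.Eventually.of_forall fun p => ?_)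
    simp only [Real.logb]
    field_simp
    rfl
  have hrl : Integrable (fun p => r p * Real.log (r p)) (ν.fst.prod ν.snd) := by
    have := (integrable_rnDeriv_smul_iff (E := ℝ) hac (f := fun p => Real.log (r p))).2 hintl
    simpa using this
  have hrlv : ∫ p, r p * Real.log (r p) ∂(ν.fst.prod ν.snd) = ∫ p, Real.log (r p) ∂ν := by
    have := integral_rnDeriv_smul (E := ℝ) hac (f := fun p => Real.log (r p))
    simpa using this
  have hIl : (∫ p, Real.log (r p) ∂ν) / Real.log 2 ≤ (miOfJoint ν).toReal := by
    rw [← integral_div]; exact hI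
  set Dx : 𝒳 → ℝ := fun x => ∫ y, r (x, y) * Real.log (r (x, y)) ∂ν.snd with hDx
  have hDxi : Integrable Dx ν.fst := hrl.integral_prod_left
  have hDxv : ∫ x, Dx x ∂ν.fst = ∫ p, Real.log (r p) ∂ν := by
    rw [← hrlv, integral_prod _ hrl]
  have hsel := selK_meas ν.snd r hr
  have hselY := selY_meas ν.snd r hr
  set c : ℕ → ℝ≥0∞ := fun k => ENNReal.ofReal (-Real.logb 2 (qc m k)) with hc
  have hcm : Measurable (fun p : 𝒳 × (ℕ → 𝒴 × ℝ) => c (selK ν.snd (fun y => r (p.1, y)) p.2)) :=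
    (measurable_of_countable c).comp hsel
  have hdm : Measurable (fun p : 𝒳 × (ℕ → 𝒴 × ℝ) => d (p.1, (p.2 (selK ν.snd (fun y => r (p.1, y)) p.2)).1)) :=
    hd.comp (measurable_fst.prodMk hselY)
  refine ⟨r, hr, ?_⟩
  apply two_point_enn (PZ ν.snd)
    (fun z => ∫⁻ x, c (selK ν.snd (fun y => r (x, y)) z) ∂ν.fst)
    (fun z => ∫⁻ x, d (x, (z (selK ν.snd (fun y => r (x, y)) z)).1) ∂ν.fst)
    hcm.lintegral_prod_left' hdm.lintegral_prod_left' _ _ ENNReal.ofReal_ne_top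
  · rw [lintegral_lintegral_swap (f := fun z x => c (selK ν.snd (fun y => r (x, y)) z))
      (hcm.comp measurable_swap).aemeasurable]
    have hgood : ∀ᵐ x ∂ν.fst, (0 ≤ (1 + 1 / m) * ((Dx x + Real.log 3) / Real.log 2) + Real.logb 2 (1 + m)) ∧
      ∫⁻ z, c (selK ν.snd (fun y => r (x, y)) z) ∂(PZ ν.snd) ≤
        ENNReal.ofReal ((1 + 1 / m) * ((Dx x + Real.log 3) / Real.log 2) + Real.logb 2 (1 + m)) := by
      filter_upwards [hfacts, hrl.prod_right_ae] with x h1 h2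
      have hrx : Measurable (fun y => r (x, y)) := hr.comp measurable_prodMk_left
      have hr0 : ∀ y, 0 ≤ r (x, y) := fun y => ENNReal.toReal_nonneg
      constructor
      · have := cost_bound hrx hr0 h1.1 h1.2 h2 0
        rw [Finset.sum_range_zero] at this
        have hlm : 0 ≤ Real.logb 2 (1 + m) := Real.logb_nonneg (by norm_num) (by linarith)
        have : 0 ≤ Dx x + Real.log 3 := this
        positivity
      · refine (sel_lint hrx hr0 h1.1 h1.2 (fun k _ => c k) (fun k => measurable_const)).trans ?_
        refine le_trans (le_of_eq ?_) (cost_enn hrx hr0 h1.1 h1.2 h2 m hm0)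
        apply tsum_congr
        intro k
        rw [lintegral_const_mul' _ _ ENNReal.ofReal_ne_top, inc_lint h1.1 h1.2]
    refine (lintegral_mono_ae (hgood.mono fun x hx => hx.2)).trans ?_
    have hi : Integrable (fun x => (1 + 1 / m) * ((Dx x + Real.log 3) / Real.log 2) + Real.logb 2 (1 + m)) ν.fst :=
      (((hDxi.add (integrable_const _)).div_const _).const_mul _).add (integrable_const _)
    rw [← ofReal_integral_eq_lintegral_ofReal hi (hgood.mono fun x hx => hx.1)]
    apply ENNReal.ofReal_le_ofReal
    have hi1 : Integrable (fun x => (Dx x + Real.log 3)) ν.fst := hDxi.add (integrable_const _)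
    rw [integral_add ((hi1.div_const _).const_mul _) (integrable_const _), integral_const_mul, integral_div,
      integral_add hDxi (integrable_const _), hDxv]
    simp only [integral_const, probReal_univ, one_smul]
    have hle : (∫ p, Real.log (r p) ∂ν + Real.log 3) / Real.log 2 ≤ m := by
      rw [hm, add_div]
      exact add_le_add hIl le_rfl
    have : (1 + 1 / m) * ((∫ p, Real.log (r p) ∂ν + Real.log 3) / Real.log 2) ≤ (1 + 1 / m) * m := by
      gcongr
    have e : (1 + 1 / m) * m = m + 1 := by field_simp
    linarith
  · rw [lintegral_lintegral_swap (f := fun (z : ℕ → 𝒴 × ℝ) (x : 𝒳) => d (x, (z (selK ν.snd (fun y => r (x, y)) z)).1))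
      (hdm.comp measurable_swap).aemeasurable]
    refine le_trans ?_ hdist
    conv_rhs => rw [← hw]
    rw [lintegral_withDensity_eq_lintegral_mul _ hRm hd, lintegral_prod _ (hRm.mul hd).aemeasurable]
    apply lintegral_mono_ae
    filter_upwards [hfacts] with x h1
    have hrx : Measurable (fun y => r (x, y)) := hr.comp measurable_prodMk_left
    have hr0 : ∀ y, 0 ≤ r (x, y) := fun y => ENNReal.toReal_nonneg
    have hdx : Measurable (fun y => d (x, y)) := hd.comp measurable_prodMk_left
    refine (sel_lint hrx hr0 h1.1 h1.2 (fun k y => d (x, y)) (fun k => hdx)).trans ?_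
    rw [← lintegral_tsum (f := fun k y => d (x, y) * ENNReal.ofReal (inc ν.snd (fun y => r (x, y)) k y))
      (fun k => (hdx.mul (inc_meas hrx k).ennreal_ofReal).aemeasurable)]
    apply lintegral_mono
    intro y
    dsimp only [Pi.mul_apply]
    rw [ENNReal.tsum_mul_left, mul_comm]
    gcongr
    refine le_trans ?_ (ENNReal.ofReal_toReal_le (a := R (x, y)))
    apply ENNReal.tsum_le_of_sum_range_le
    intro N
    rw [← ENNReal.ofReal_sum_of_nonneg (fun k _ => inc_nonneg h1.1 h1.2 k y), inc_sum _ _ hr0]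
    exact ENNReal.ofReal_le_ofReal (min_le_left _ _)

lemma final_arith (I : ℝ) (hI : 0 ≤ I) :
    1 + ((I + Real.logb 2 3) + 1 + Real.logb 2 (1 + (I + Real.logb 2 3))) ≤ I + Real.logb 2 (I + 1) + 5 := by
  have h3 : 3 * Real.logb 2 3 ≤ 5 := by
    have e : 3 * Real.logb 2 3 = Real.logb 2 27 := by
      rw [show (27:ℝ) = 3 ^ (3:ℕ) by norm_num, Real.logb_pow]; norm_num
    rw [e, Real.logb_le_iff_le_rpow (by norm_num) (by norm_num)]
    norm_num
  have hp : 0 ≤ Real.logb 2 3 := Real.logb_nonneg (by norm_num) (by norm_num)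
  have e8 : Real.logb 2 8 = 3 := by
    rw [show (8:ℝ) = 2 ^ (3:ℕ) by norm_num, Real.logb_pow]; norm_num
  have : Real.logb 2 3 + Real.logb 2 (1 + (I + Real.logb 2 3)) ≤ Real.logb 2 8 + Real.logb 2 (I + 1) := by
    rw [← Real.logb_mul (by norm_num) (by positivity), ← Real.logb_mul (by norm_num) (by positivity)]
    apply Real.logb_le_logb_of_le (by norm_num) (by positivity)
    linarith
  linarith

/-- **Key lemma for one-shot lossy coding** (derandomization step in the proof of Theorem 2).
Given `X ∼ P_X`, a distortion measure `d` and a joint law `ν` (with `X`-marginal `P_X`)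
satisfying `E_ν[d(X,Y)] ≤ D` and `I(X;Y) < ∞`, there is a reconstruction `Yt` obtained from
`X` and a single independent random bit `Q` (i.e. `Yt = f_Q(X)` for two deterministic
measurable maps `f₀, f₁`; `Q` is Bernoulli with some bias `λ = μ'(Q = true)`) such that
`H(Yt) ≤ I(X;Y) + log₂(I(X;Y)+1) + 5` and `E[d(X,Yt)] ≤ D`. -/
theorem one_shot_lossy_coding_key_lemma
    {Ω 𝒳 𝒴 : Type*} [MeasurableSpace Ω]
    [TopologicalSpace 𝒳] [PolishSpace 𝒳] [MeasurableSpace 𝒳] [BorelSpace 𝒳]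
    [TopologicalSpace 𝒴] [PolishSpace 𝒴] [MeasurableSpace 𝒴] [BorelSpace 𝒴]
    (μ : Measure Ω) [IsProbabilityMeasure μ]
    (X : Ω → 𝒳) (hX : Measurable X)
    (d : 𝒳 × 𝒴 → ℝ≥0∞) (hd : Measurable d) (D : ℝ≥0∞)
    (ν : Measure (𝒳 × 𝒴)) [IsProbabilityMeasure ν]
    (hmarg : ν.fst = μ.map X)
    (hdist : ∫⁻ p, d p ∂ν ≤ D)
    (hfin : miOfJoint ν ≠ ⊤) :
    ∃ (Ω' : Type) (_ : MeasurableSpace Ω') (μ' : Measure Ω') (_ : IsProbabilityMeasure μ')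
      (X' : Ω' → 𝒳) (Q : Ω' → Bool) (f₀ f₁ : 𝒳 → 𝒴),
      Measurable X' ∧ Measurable Q ∧ Measurable f₀ ∧ Measurable f₁ ∧
      -- X' has the law of the source X
      μ'.map X' = μ.map X ∧
      -- the Bernoulli bit Q is independent of X
      IndepFun X' Q μ' ∧
      -- with Yt = f_Q(X) :
      (fun Yt : Ω' → 𝒴 =>
        -- H(Yt) ≤ I(X;Y) + log₂(I(X;Y)+1) + 5
        entBits μ' Yt ≤
          ENNReal.ofReal ((miOfJoint ν).toReal +
            Real.logb 2 ((miOfJoint ν).toReal + 1) + 5) ∧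
        -- E[d(X,Yt)] ≤ D
        ∫⁻ ω, d (X' ω, Yt ω) ∂μ' ≤ D)
        (fun ω => if Q ω then f₁ (X' ω) else f₀ (X' ω)) := by

  classical
  haveI hPX : IsProbabilityMeasure ν.fst := inferInstance
  haveI : Nonempty 𝒳 := by
    by_contra h
    rw [not_nonempty_iff] at h
    have := measure_univ (μ := ν.fst)
    rw [Set.univ_eq_empty_iff.2 h] at this
    simp at this
  set I := (miOfJoint ν).toReal with hI
  have hI0 : 0 ≤ I := ENNReal.toReal_nonneg
  have h3 : 0 < Real.logb 2 3 := Real.logb_pos (by norm_num) (by norm_num)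
  set m := I + Real.logb 2 3 with hm
  have hm0 : 0 < m := by linarith
  obtain ⟨r, hr, z0, z1, t, t0, t1, hH, hδ⟩ := exists_codes ν hfin d hd D hdist m hm0 hm
  have hsel := selK_meas ν.snd r hr
  have hselY := selY_meas ν.snd r hr
  have he := measurableEmbedding_embeddingReal 𝒳
  let B : Measure Bool := ENNReal.ofReal t • Measure.dirac true + ENNReal.ofReal (1 - t) • Measure.dirac false
  have hB : IsProbabilityMeasure B := by
    constructor
    simp only [B, Measure.add_apply, Measure.smul_apply, measure_univ, smul_eq_mul, mul_one]
    rw [← ENNReal.ofReal_add t0 (by linarith)]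
    simp
  let E := ν.fst.map (embeddingReal 𝒳)
  haveI hE : IsProbabilityMeasure E := Measure.isProbabilityMeasure_map he.measurable.aemeasurable
  let g : ℝ → 𝒳 := he.invFun
  have hg : Measurable g := he.measurable_invFun
  have hge : ∀ x, g (embeddingReal 𝒳 x) = x := he.leftInverse_invFun
  have hEg : E.map g = ν.fst := by
    simp only [E]
    rw [Measure.map_map hg he.measurable]
    have : g ∘ embeddingReal 𝒳 = id := funext hge
    rw [this, Measure.map_id]
  have hlint : ∀ F : 𝒳 × Bool → ℝ≥0∞, Measurable F →
      ∫⁻ ω, F (g ω.1, ω.2) ∂(E.prod B) = ENNReal.ofReal t * ∫⁻ x, F (x, true) ∂ν.fst +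
        ENNReal.ofReal (1 - t) * ∫⁻ x, F (x, false) ∂ν.fst := by
    intro F hF
    have hFm : Measurable (fun ω : ℝ × Bool => F (g ω.1, ω.2)) :=
      hF.comp ((hg.comp measurable_fst).prodMk measurable_snd)
    have hFt : ∀ b, Measurable (fun x => F (x, b)) := fun b => hF.comp measurable_prodMk_right
    rw [lintegral_prod _ hFm.aemeasurable]
    simp only [B, lintegral_add_measure, lintegral_smul_measure, lintegral_dirac, smul_eq_mul]
    have hFg : ∀ b, Measurable (fun x => F (g x, b)) := fun b => (hFt b).comp hg
    have hch : ∀ b, ∫⁻ x, F (x, b) ∂ν.fst = ∫⁻ x, F (g x, b) ∂E := by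
      intro b
      conv_lhs => rw [← hEg]
      exact lintegral_map (hFt b) hg
    rw [hch, hch, lintegral_add_left ((hFg true).const_mul _), lintegral_const_mul _ (hFg true),
      lintegral_const_mul _ (hFg false)]
  let f : (ℕ → 𝒴 × ℝ) → 𝒳 → 𝒴 := fun z x => (z (selK ν.snd (fun y => r (x, y)) z)).1
  have hf : ∀ z, Measurable (f z) := fun z => hselY.comp measurable_prodMk_right
  have hk : ∀ z, Measurable (fun x => selK ν.snd (fun y => r (x, y)) z) := fun z => hsel.comp measurable_prodMk_right
  refine ⟨ℝ × Bool, inferInstance, E.prod B, inferInstance, fun ω => g ω.1, fun ω => ω.2, f z1, f z0,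
    hg.comp measurable_fst, measurable_snd, hf z1, hf z0, ?_, ?_, ?_, ?_⟩
  · rw [← hmarg]
    change Measure.map (g ∘ Prod.fst) (E.prod B) = ν.fst
    rw [← Measure.map_map hg measurable_fst, Measure.map_fst_prod, measure_univ, one_smul, hEg]
  · exact indepFun_prod hg measurable_id
  · let zz : Bool → ℕ → 𝒴 × ℝ := fun b => if b then z0 else z1
    let S : 𝒳 × Bool → Bool × ℕ := fun p => (p.2, selK ν.snd (fun y => r (p.1, y)) (zz p.2))
    have hS : Measurable S :=
      measurable_from_prod_countable_left (fun b => measurable_const.prodMk (hk (zz b)))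
    have hgX : Measurable (fun ω : ℝ × Bool => (g ω.1, ω.2)) := (hg.comp measurable_fst).prodMk measurable_snd
    have hent := entBits_le (E.prod B) (fun ω : ℝ × Bool => S (g ω.1, ω.2)) (hS.comp hgX)
      (fun p => (zz p.1 p.2).1) (fun p => qc m p.2 / 2) (fun p => half_pos (qc_pos m hm0 p.2))
      (fun p => by
        have := ENNReal.le_tsum (f := fun k => ENNReal.ofReal (qc m k)) p.2
        have := this.trans (qc_sum m hm0)
        have h1 : qc m p.2 ≤ 1 := by simpa using this
        linarith)
      (by
        rw [ENNReal.tsum_prod (f := fun (_ : Bool) k => ENNReal.ofReal (qc m k / 2)), tsum_bool]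
        have e : ∀ k, ENNReal.ofReal (qc m k / 2) = ENNReal.ofReal (qc m k) * 2⁻¹ := by
          intro k
          rw [ENNReal.ofReal_div_of_pos (by norm_num), div_eq_mul_inv]; simp
        simp_rw [e]
        rw [ENNReal.tsum_mul_right, ← mul_add, ENNReal.inv_two_add_inv_two, mul_one]
        exact qc_sum m hm0)
    have hYt : (fun ω : ℝ × Bool => if ω.2 = true then f z0 (g ω.1) else f z1 (g ω.1)) =
        fun ω => (zz (S (g ω.1, ω.2)).1 (S (g ω.1, ω.2)).2).1 := by
      funext ω
      rcases ω with ⟨a, b⟩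
      cases b <;> simp [f, S, zz]
    rw [hYt]
    refine hent.trans ?_
    rw [hlint (fun p => ENNReal.ofReal (-Real.logb 2 (qc m (S p).2 / 2)))
      ((measurable_of_countable (fun q : Bool × ℕ => ENNReal.ofReal (-Real.logb 2 (qc m q.2 / 2)))).comp hS)]
    have hstep : ∀ z : ℕ → 𝒴 × ℝ, ∫⁻ x, ENNReal.ofReal (-Real.logb 2 (qc m (selK ν.snd (fun y => r (x, y)) z) / 2)) ∂ν.fst
        ≤ 1 + ∫⁻ x, ENNReal.ofReal (-Real.logb 2 (qc m (selK ν.snd (fun y => r (x, y)) z))) ∂ν.fst := by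
      intro z
      have : (1 : ℝ≥0∞) = ∫⁻ _, 1 ∂ν.fst := by simp
      rw [this, ← lintegral_add_left measurable_const]
      apply lintegral_mono
      intro x
      dsimp only
      rw [Real.logb_div (qc_pos m hm0 _).ne' (by norm_num), Real.logb_self_eq_one (by norm_num), neg_sub, sub_eq_add_neg]
      exact ENNReal.ofReal_add_le.trans (by simp)
    calc _ ≤ ENNReal.ofReal t * (1 + ∫⁻ x, ENNReal.ofReal (-Real.logb 2 (qc m (selK ν.snd (fun y => r (x, y)) z0))) ∂ν.fst)
        + ENNReal.ofReal (1 - t) * (1 + ∫⁻ x, ENNReal.ofReal (-Real.logb 2 (qc m (selK ν.snd (fun y => r (x, y)) z1))) ∂ν.fst) :=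
          add_le_add (mul_le_mul_right (hstep z0) _) (mul_le_mul_right (hstep z1) _)
      _ = ENNReal.ofReal (t + (1 - t)) + (ENNReal.ofReal t * ∫⁻ x, ENNReal.ofReal (-Real.logb 2 (qc m (selK ν.snd (fun y => r (x, y)) z0))) ∂ν.fst
        + ENNReal.ofReal (1 - t) * ∫⁻ x, ENNReal.ofReal (-Real.logb 2 (qc m (selK ν.snd (fun y => r (x, y)) z1))) ∂ν.fst) := by
          rw [ENNReal.ofReal_add t0 (by linarith)]; ring
      _ ≤ ENNReal.ofReal 1 + ENNReal.ofReal (m + 1 + Real.logb 2 (1 + m)) := by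
          rw [add_sub_cancel]; gcongr
      _ = ENNReal.ofReal (1 + (m + 1 + Real.logb 2 (1 + m))) := by
          rw [ENNReal.ofReal_add zero_le_one]
          have : 0 ≤ Real.logb 2 (1 + m) := Real.logb_nonneg (by norm_num) (by linarith)
          linarith
      _ ≤ _ := ENNReal.ofReal_le_ofReal (final_arith I hI0)
  · have hF : Measurable (fun p : 𝒳 × Bool => d (p.1, if p.2 = true then f z0 p.1 else f z1 p.1)) :=
      measurable_from_prod_countable_left (fun b => by
        cases b
        · simp only [Bool.false_eq_true, if_false]; exact hd.comp (measurable_id.prodMk (hf z1))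
        · simp only [if_true]; exact hd.comp (measurable_id.prodMk (hf z0)))
    have := hlint _ hF
    refine (le_of_eq this).trans ?_
    simpa using hδ
end
end
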